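/- Stability of strong mixing under inhomogeneous activity perturbations. Let U = (z, U_{>1}) be a translationally invariant finite-range lattice gas potential on {0,1}^{ℤ^d} with activity z and interaction U_{>1}, satisfying SM(ℓ0,b,B). Then there exist ε > 0, an integer ℓ0' which is a multiple of ℓ0, and positive reals b' = b'(ε,b,B,ℓ0), B' = B'(ε,b,B,ℓ0) < ∞, such that for every family of activities z̲ = (z_x)_{x∈ℤ^d} with |z_x − z| ≤ ε for all x ∈ ℤ^d, the lattice gas potential with inhomogeneous activity U^{z̲} = (z̲, U_{>1}) satisfies SM(ℓ0',b',B'). -/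

import Mathlib

namespace Paper

open MeasureTheory
open scoped Classical

noncomputable section

/-- The lattice `ℤ^d`. -/
abbrev ZLat (d : ℕ) := Fin d → ℤ

/-- A lattice gas configuration `η ∈ {0,1}^{ℤ^d}` (`true` = occupied). -/
abbrev GConf (d : ℕ) := ZLat d → Bool

/-- The sup distance on `ℤ^d`. -/
def supD {d : ℕ} (x y : ZLat d) : ℕ := Finset.univ.sup fun i => (x i - y i).natAbs

/-- The sup distance between two finite subsets of the lattice. -/
def fDist {d : ℕ} (A B : Finset (ZLat d)) : ℝ :=
  sInf ((fun p : ZLat d × ZLat d => (supD p.1 p.2 : ℝ)) '' {p | p.1 ∈ A ∧ p.2 ∈ B})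

/-- `f` is a local function with support contained in the finite set `S`. -/
def LocalOn {d : ℕ} (f : GConf d → ℝ) (S : Finset (ZLat d)) : Prop :=
  ∀ σ τ : GConf d, (∀ x ∈ S, σ x = τ x) → f σ = f τ

/-- Sup norm of a real valued function. -/
def supNorm {α : Type*} (f : α → ℝ) : ℝ := ⨆ a, |f a|

/-- The cube `Q_ℓ(i) ⊆ ℤ^d` of side `ℓ` whose lowest corner is the site `ℓ·i`. -/
def cube {d : ℕ} (ℓ : ℕ) (i : ZLat d) : Finset (ZLat d) :=
  Fintype.piFinset fun k => Finset.Ico ((ℓ : ℤ) * i k) ((ℓ : ℤ) * i k + ℓ)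

/-- The Hamiltonian `H_Λ(σ) = ∑_{X ∩ Λ ≠ ∅} Φ_X(σ)` of a potential `Φ`. -/
def hamil {d : ℕ} (Φ : Finset (ZLat d) → GConf d → ℝ) (Λ : Finset (ZLat d))
    (σ : GConf d) : ℝ :=
  ∑' X : Finset (ZLat d), if (X ∩ Λ).Nonempty then Φ X σ else 0

/-- The configuration equal to `σ` inside `Λ` and to the boundary condition `τ`
outside `Λ`. -/
def override {d : ℕ} (Λ : Finset (ZLat d)) (σ : ↥Λ → Bool) (τ : GConf d) : GConf d :=
  fun x => if h : x ∈ Λ then σ ⟨x, h⟩ else τ x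

/-- The finite volume partition function `Z_Λ(τ)`. -/
def partFun {d : ℕ} (Φ : Finset (ZLat d) → GConf d → ℝ) (Λ : Finset (ZLat d))
    (τ : GConf d) : ℝ :=
  ∑ σ : ↥Λ → Bool, Real.exp (hamil Φ Λ (override Λ σ τ))

/-- The expectation of `f` under the finite volume Gibbs measure `μ_Λ^τ`. -/
def gibbsExp {d : ℕ} (Φ : Finset (ZLat d) → GConf d → ℝ) (Λ : Finset (ZLat d))
    (τ : GConf d) (f : GConf d → ℝ) : ℝ :=
  (∑ σ : ↥Λ → Bool, Real.exp (hamil Φ Λ (override Λ σ τ)) * f (override Λ σ τ)) /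
    partFun Φ Λ τ

/-- The finite region `⋃_{i ∈ I} Q_{ℓ0}(i)`: a finite union of cubes of side `ℓ0`
from the partition of `ℤ^d` into such cubes. -/
def cubesRegion {d : ℕ} (ℓ0 : ℕ) (I : Finset (ZLat d)) : Finset (ZLat d) :=
  I.biUnion (cube ℓ0)

/-- Condition SM(ℓ0, b, B) (strong mixing) for the potential `Φ`. -/
def SM {d : ℕ} (Φ : Finset (ZLat d) → GConf d → ℝ) (ℓ0 : ℕ) (b B : ℝ) : Prop :=
  ∀ (I : Finset (ZLat d)) (f g : GConf d → ℝ) (Sf Sg : Finset (ZLat d)),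
    LocalOn f Sf → LocalOn g Sg →
    Sf ⊆ cubesRegion ℓ0 I → Sg ⊆ cubesRegion ℓ0 I →
    (min Sf.card Sg.card : ℝ) * Real.exp (-b * fDist Sf Sg) ≤ 1 →
    ∀ τ : GConf d,
      |gibbsExp Φ (cubesRegion ℓ0 I) τ (fun σ => f σ * g σ) -
          gibbsExp Φ (cubesRegion ℓ0 I) τ f * gibbsExp Φ (cubesRegion ℓ0 I) τ g| ≤
        B * supNorm f * supNorm g * (min Sf.card Sg.card : ℝ) *
          Real.exp (-b * fDist Sf Sg)

/-- A translationally invariant finite-range lattice gas interaction, together with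
an activity `z > 0`; `U_X` vanishes unless `|X| > 1`, is a local function of the
coordinates in `X`, has range `r` and is translationally invariant. -/
structure LatticeGas (d : ℕ) where
  z : ℝ
  zpos : 0 < z
  U : Finset (ZLat d) → GConf d → ℝ
  r : ℕ
  Ulocal : ∀ X, LocalOn (U X) X
  Upair : ∀ X : Finset (ZLat d), X.card ≤ 1 → U X = 0
  Urange : ∀ X : Finset (ZLat d), ∀ x ∈ X, ∀ y ∈ X, r < supD x y → U X = 0
  UtransInv : ∀ (X : Finset (ZLat d)) (i : ZLat d) (σ : GConf d),
    U (X.image (· + i)) σ = U X fun x => σ (x + i)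

/-- The full lattice gas potential determined by the interaction `G.U` and a
(possibly inhomogeneous) family of activities `zf`: single-site terms
`η_x ↦ η_x log (zf x)` and interaction `U_X` for `|X| > 1`. -/
def gasPot {d : ℕ} (G : LatticeGas d) (zf : ZLat d → ℝ) :
    Finset (ZLat d) → GConf d → ℝ :=
  fun X σ =>
    if X.card = 1 then ∑ x ∈ X, (if σ x then Real.log (zf x) else 0) else G.U X σ

/-- The homogeneous lattice gas potential with activity `G.z`. -/
def gasPotH {d : ℕ} (G : LatticeGas d) : Finset (ZLat d) → GConf d → ℝ :=
  gasPot G fun _ => G.z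

/-- `μ` is an infinite volume Gibbs measure for the potential `Φ` (DLR equations). -/
def IsGibbs {d : ℕ} (Φ : Finset (ZLat d) → GConf d → ℝ)
    (μ : Measure (GConf d)) : Prop :=
  ∀ (Λ : Finset (ZLat d)) (f : GConf d → ℝ) (S : Finset (ZLat d)), LocalOn f S →
    (∫ τ, gibbsExp Φ Λ τ f ∂μ) = ∫ σ, f σ ∂μ

/-- The occupation number `η_x ∈ {0,1}` as a real number. -/
def occ {d : ℕ} (x : ZLat d) (η : GConf d) : ℝ := if η x then 1 else 0

/-- The equilibrium density `ρ = μ(η_0)`. -/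
def rho {d : ℕ} (μ : Measure (GConf d)) : ℝ := ∫ η, occ 0 η ∂μ

/-- The compressibility `χ = ∑_x [μ(η_0 η_x) − μ(η_0) μ(η_x)]`. -/
def chi {d : ℕ} (μ : Measure (GConf d)) : ℝ :=
  ∑' x : ZLat d, ((∫ η, occ 0 η * occ x η ∂μ) - rho μ * ∫ η, occ x η ∂μ)

/-- The centered and normalized block variable
`M_i^{(ℓ)}(η) = (∑_{x ∈ Q_ℓ(i)} η_x − ρℓ^d) / √(ℓ^d χ)`. -/
def Mblk {d : ℕ} (μ : Measure (GConf d)) (ℓ : ℕ) (i : ZLat d) (η : GConf d) : ℝ :=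
  ((∑ x ∈ cube ℓ i, occ x η) - rho μ * (ℓ : ℝ) ^ d) / Real.sqrt ((ℓ : ℝ) ^ d * chi μ)

/-- The renormalized measure `ν^{(ℓ)}`: the image of `μ` under the block averaging
map `η ↦ (M_i^{(ℓ)}(η))_i`. -/
def nu {d : ℕ} (μ : Measure (GConf d)) (ℓ : ℕ) : Measure (ZLat d → ℝ) :=
  μ.map fun η => fun i => Mblk μ ℓ i η

/-- The (finite) single-site renormalized configuration space `ℳ_i^{(ℓ)}`. -/
def Mset (d : ℕ) (μ : Measure (GConf d)) (ℓ : ℕ) : Finset ℝ :=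
  (Finset.range (ℓ ^ d + 1)).image fun k =>
    ((k : ℝ) - rho μ * (ℓ : ℝ) ^ d) / Real.sqrt ((ℓ : ℝ) ^ d * chi μ)


/-! ### Weighted averages on a finite type -/

/-- The average of `F` with respect to the unnormalized weight `m`. -/
def wAvg {A : Type*} [Fintype A] (m F : A → ℝ) : ℝ := (∑ a, m a * F a) / ∑ a, m a

lemma sum_weight_pos {A : Type*} [Fintype A] [Nonempty A] {m : A → ℝ} (hm : ∀ a, 0 < m a) :
    0 < ∑ a, m a :=
  Finset.sum_pos (fun a _ => hm a) Finset.univ_nonempty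

lemma abs_wAvg_sub_le {A : Type*} [Fintype A] [Nonempty A] {m F F' : A → ℝ} {u : ℝ}
    (hm : ∀ a, 0 < m a) (h : ∀ a, |F a - F' a| ≤ u) : |wAvg m F - wAvg m F'| ≤ u := by
  have hZ := sum_weight_pos hm
  unfold wAvg
  rw [← sub_div, abs_div, abs_of_pos hZ, div_le_iff₀ hZ, ← Finset.sum_sub_distrib, Finset.mul_sum]
  refine (Finset.abs_sum_le_sum_abs _ _).trans (Finset.sum_le_sum fun a _ => ?_)
  rw [← mul_sub, abs_mul, abs_of_pos (hm a), mul_comm]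
  exact mul_le_mul_of_nonneg_right (h a) (hm a).le

lemma wAvg_const {A : Type*} [Fintype A] [Nonempty A] {m : A → ℝ} (hm : ∀ a, 0 < m a) (c : ℝ) :
    wAvg m (fun _ => c) = c := by
  have hZ := sum_weight_pos hm
  unfold wAvg
  rw [← Finset.sum_mul]
  field_simp

lemma wAvg_add_const {A : Type*} [Fintype A] [Nonempty A] {m : A → ℝ} (hm : ∀ a, 0 < m a)
    (F : A → ℝ) (c : ℝ) : wAvg m (fun a => F a + c) = wAvg m F + c := by
  have hZ := sum_weight_pos hm
  unfold wAvg
  simp only [mul_add, Finset.sum_add_distrib, ← Finset.sum_mul]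
  field_simp

lemma abs_wAvg_le {A : Type*} [Fintype A] [Nonempty A] {m F : A → ℝ} {u : ℝ}
    (hm : ∀ a, 0 < m a) (h : ∀ a, |F a| ≤ u) : |wAvg m F| ≤ u := by
  have := abs_wAvg_sub_le (F' := fun _ => 0) hm (by simpa using h)
  simpa [wAvg_const hm] using this

lemma le_wAvg {A : Type*} [Fintype A] [Nonempty A] {m F : A → ℝ} {u : ℝ}
    (hm : ∀ a, 0 < m a) (h : ∀ a, u ≤ F a) : u ≤ wAvg m F := by
  unfold wAvg
  rw [le_div_iff₀ (sum_weight_pos hm), Finset.mul_sum]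
  refine Finset.sum_le_sum fun a _ => ?_
  rw [mul_comm]
  exact mul_le_mul_of_nonneg_left (h a) (hm a).le

/-- Tilting the weight changes the average by a normalized covariance. -/
lemma wAvg_tilt_sub {A : Type*} [Fintype A] [Nonempty A] {m ρ : A → ℝ} (F : A → ℝ)
    (hm : ∀ a, 0 < m a) (hρ : ∀ a, 0 < ρ a) :
    wAvg (fun a => m a * ρ a) F - wAvg m F =
      (wAvg m (fun a => F a * ρ a) - wAvg m F * wAvg m ρ) / wAvg m ρ := by
  have hZ := sum_weight_pos hm
  have hZ' := sum_weight_pos (fun a => mul_pos (hm a) (hρ a))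
  have e : ∑ a, m a * ρ a * F a = ∑ a, m a * (F a * ρ a) :=
    Finset.sum_congr rfl fun a _ => by ring
  unfold wAvg
  rw [e]
  field_simp

/-- Multiplicative stability of averages under a bounded change of the energy. -/
lemma abs_wAvg_exp_sub_le {A : Type*} [Fintype A] [Nonempty A] {H H' F : A → ℝ} {t u : ℝ}
    (hH : ∀ a, |H' a - H a| ≤ t) (hF : ∀ a, |F a| ≤ u) :
    |wAvg (fun a => Real.exp (H' a)) F - wAvg (fun a => Real.exp (H a)) F| ≤
      (Real.exp (2 * t) - 1) * u := by
  have hm : ∀ a, 0 < Real.exp (H a) := fun a => Real.exp_pos _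
  have hm' : ∀ a, 0 < Real.exp (H' a) := fun a => Real.exp_pos _
  have hZ := sum_weight_pos hm
  have hZ' := sum_weight_pos hm'
  set Z := ∑ a, Real.exp (H a)
  set Z' := ∑ a, Real.exp (H' a)
  have hZZ' : Z ≤ Real.exp t * Z' := by
    rw [Finset.mul_sum]
    refine Finset.sum_le_sum fun a _ => ?_
    rw [← Real.exp_add]
    exact Real.exp_le_exp.2 (by linarith [(abs_le.1 (hH a)).1])
  have hZ'Z : Z' ≤ Real.exp t * Z := by
    rw [Finset.mul_sum]
    refine Finset.sum_le_sum fun a _ => ?_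
    rw [← Real.exp_add]
    exact Real.exp_le_exp.2 (by linarith [(abs_le.1 (hH a)).2])
  have key : ∀ a, |Real.exp (H' a) / Z' - Real.exp (H a) / Z| ≤
      Real.exp (H a) / Z * (Real.exp (2 * t) - 1) := by
    intro a
    have hee : Real.exp t * Real.exp (-t) = 1 := by rw [← Real.exp_add]; simp
    have h2 : Real.exp (2 * t) = Real.exp t * Real.exp t := by rw [← Real.exp_add]; ring_nf
    have h2' : Real.exp (-(2 * t)) = Real.exp (-t) * Real.exp (-t) := by
      rw [← Real.exp_add]; ring_nf
    have up : Real.exp (H' a) / Z' ≤ Real.exp (H a) / Z * Real.exp (2 * t) := by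
      rw [div_mul_eq_mul_div, div_le_div_iff₀ hZ' hZ]
      have h1 : Real.exp (H' a) ≤ Real.exp t * Real.exp (H a) := by
        rw [← Real.exp_add]
        exact Real.exp_le_exp.2 (by linarith [(abs_le.1 (hH a)).2])
      calc Real.exp (H' a) * Z ≤ (Real.exp t * Real.exp (H a)) * (Real.exp t * Z') :=
            mul_le_mul h1 hZZ' hZ.le (by positivity)
        _ = _ := by rw [h2]; ring
    have lo : Real.exp (H a) / Z * Real.exp (-(2 * t)) ≤ Real.exp (H' a) / Z' := by
      rw [div_mul_eq_mul_div, div_le_div_iff₀ hZ hZ']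
      have h1 : Real.exp (-t) * Real.exp (H a) ≤ Real.exp (H' a) := by
        rw [← Real.exp_add]
        exact Real.exp_le_exp.2 (by linarith [(abs_le.1 (hH a)).1])
      have h3 : Real.exp (-t) * Z' ≤ Z := by
        calc Real.exp (-t) * Z' ≤ Real.exp (-t) * (Real.exp t * Z) :=
              mul_le_mul_of_nonneg_left hZ'Z (Real.exp_pos _).le
          _ = (Real.exp t * Real.exp (-t)) * Z := by ring
          _ = Z := by rw [hee, one_mul]
      calc Real.exp (H a) * Real.exp (-(2 * t)) * Z'
          = (Real.exp (-t) * Real.exp (H a)) * (Real.exp (-t) * Z') := by rw [h2']; ring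
        _ ≤ Real.exp (H' a) * Z := mul_le_mul h1 h3 (by positivity) (Real.exp_pos _).le
    have hsum : 2 ≤ Real.exp (2 * t) + Real.exp (-(2 * t)) := by
      nlinarith [sq_nonneg (Real.exp t - Real.exp (-t)), hee, h2, h2']
    have hp : 0 < Real.exp (H a) / Z := by positivity
    rw [abs_le]
    constructor <;> nlinarith
  have e : ∀ (K : A → ℝ), wAvg (fun a => Real.exp (K a)) F =
      ∑ a, Real.exp (K a) / (∑ a, Real.exp (K a)) * F a := by
    intro K
    unfold wAvg
    rw [Finset.sum_div]
    exact Finset.sum_congr rfl fun a _ => by ring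
  rw [e, e, ← Finset.sum_sub_distrib]
  calc |∑ a, (Real.exp (H' a) / Z' * F a - Real.exp (H a) / Z * F a)|
      ≤ ∑ a, Real.exp (H a) / Z * (Real.exp (2 * t) - 1) * u := by
        refine (Finset.abs_sum_le_sum_abs _ _).trans (Finset.sum_le_sum fun a _ => ?_)
        rw [← sub_mul, abs_mul]
        exact mul_le_mul (key a) (hF a) (abs_nonneg _) ((abs_nonneg _).trans (key a))
    _ = (Real.exp (2 * t) - 1) * u := by
        simp only [mul_assoc]
        rw [← Finset.sum_mul, ← Finset.sum_div, div_self hZ.ne', one_mul]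

/-! ### Functions that are Lipschitz for a weighted Hamming distance -/

/-- `F` is `1`-Lipschitz for the Hamming distance with site weights `w`. -/
def HamLip {S : Type*} [Fintype S] (w : S → ℝ) (F : (S → Bool) → ℝ) : Prop :=
  ∀ η η' : S → Bool, |F η - F η'| ≤ ∑ x, if η x ≠ η' x then w x else 0

lemma HamLip.of_single_site {S : Type*} [Fintype S] {w : S → ℝ}
    {F : (S → Bool) → ℝ}
    (h : ∀ y, ∀ η η' : S → Bool, (∀ x, x ≠ y → η x = η' x) → |F η - F η'| ≤ w y) :
    HamLip w F := by
  intro η η'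
  have key : ∀ T : Finset S, |F η - F (fun x => if x ∈ T then η' x else η x)| ≤
      ∑ x ∈ T, if η x ≠ η' x then w x else 0 := by
    intro T
    induction T using Finset.induction_on with
    | empty => simp
    | insert a T ha ih =>
      rw [Finset.sum_insert ha]
      have step : |F (fun x => if x ∈ T then η' x else η x) -
          F (fun x => if x ∈ insert a T then η' x else η x)| ≤ if η a ≠ η' a then w a else 0 := by
        split_ifs with hne
        · refine h a _ _ fun x hx => ?_
          simp [Finset.mem_insert, hx]
        · have : (fun x => if x ∈ T then η' x else η x) =
              (fun x => if x ∈ insert a T then η' x else η x) := by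
            funext x
            by_cases hx : x = a
            · subst hx
              simp [ha]
              simpa using hne
            · simp [Finset.mem_insert, hx]
          rw [this]; simp
      calc _ ≤ |F η - F (fun x => if x ∈ T then η' x else η x)| +
            |F (fun x => if x ∈ T then η' x else η x) -
              F (fun x => if x ∈ insert a T then η' x else η x)| := abs_sub_le _ _ _
        _ ≤ _ := by linarith
  simpa using key Finset.univ

/-- A function that is Lipschitz for the weights `v + u` is within `∑ u` of a function that is
Lipschitz for the weights `v`. -/
lemma HamLip.exists_approx {S : Type*} [Fintype S] {v u : S → ℝ}
    (hv : ∀ x, 0 ≤ v x) (hu : ∀ x, 0 ≤ u x) {F : (S → Bool) → ℝ}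
    (hF : HamLip (fun x => v x + u x) F) :
    ∃ F₁, HamLip v F₁ ∧ ∀ η, F₁ η ≤ F η ∧ F η ≤ F₁ η + ∑ x, u x := by
  set D : (S → Bool) → (S → Bool) → ℝ := fun η ξ => ∑ x, if η x ≠ ξ x then v x else 0 with hD
  have hne : (Finset.univ : Finset (S → Bool)).Nonempty := Finset.univ_nonempty
  set F₁ : (S → Bool) → ℝ := fun η => Finset.univ.inf' hne fun ξ => F ξ + D η ξ with hF₁
  have hle : ∀ η ξ, F₁ η ≤ F ξ + D η ξ := fun η ξ =>
    Finset.inf'_le (fun ξ => F ξ + D η ξ) (Finset.mem_univ ξ)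
  have htri : ∀ η η' ξ, D η ξ ≤ D η η' + D η' ξ := by
    intro η η' ξ
    rw [hD]
    simp only
    rw [← Finset.sum_add_distrib]
    refine Finset.sum_le_sum fun x _ => ?_
    have := hv x
    by_cases h1 : η x = η' x
    · simp [h1]
    · split_ifs <;> linarith
  have hsymm : ∀ η η', D η η' = D η' η := by
    intro η η'
    simp only [hD, ne_comm]
  have hlip : ∀ η η', F₁ η - F₁ η' ≤ D η η' := by
    intro η η'
    obtain ⟨ξ, -, hξ⟩ := Finset.exists_mem_eq_inf' hne fun ξ => F ξ + D η' ξ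
    have h1 : F₁ η' = F ξ + D η' ξ := hξ
    linarith [hle η ξ, htri η η' ξ]
  refine ⟨F₁, fun η η' => abs_le.2 ⟨?_, hlip η η'⟩, fun η => ⟨?_, ?_⟩⟩
  · have := hlip η' η
    have h2 := hsymm η η'
    simp only [hD] at this h2 ⊢
    linarith
  · have := hle η η
    simpa [hD] using this
  · obtain ⟨ξ, -, hξ⟩ := Finset.exists_mem_eq_inf' hne fun ξ => F ξ + D η ξ
    have h1 : F₁ η = F ξ + D η ξ := hξ
    have h2 := (abs_le.1 (hF η ξ)).2
    have h3 : (∑ x, if η x ≠ ξ x then v x + u x else 0) ≤ D η ξ + ∑ x, u x := by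
      rw [hD]
      simp only
      rw [← Finset.sum_add_distrib]
      refine Finset.sum_le_sum fun x _ => ?_
      have := hu x
      split_ifs <;> linarith
    linarith

/-- Contraction argument: a functional invariant under block averages, which contract the
weighted Hamming-Lipschitz seminorm away from `near`, is controlled by the weights on `near`. -/
theorem abs_functional_le_of_contraction {S ι : Type*} [Fintype S] [DecidableEq S]
    {w : S → ℝ} (hw : ∀ x, 0 ≤ w x) {q : (S → Bool) → ℝ} {A : ℝ}
    (hq : ∀ (F : (S → Bool) → ℝ) (u : ℝ), (∀ η η', |F η - F η'| ≤ u) →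
      |∑ η, q η * F η| ≤ A * u)
    (J : Finset ι) (V bd : ι → S → Prop) (E : ι → ((S → Bool) → ℝ) → (S → Bool) → ℝ)
    (hE : ∀ j ∈ J, ∀ F, ∑ η, q η * E j F η = ∑ η, q η * F η)
    {M n : ℝ} (hn : 0 < n)
    (hosc : ∀ j ∈ J, ∀ F, HamLip w F → ∀ y, ∀ η η' : S → Bool, (∀ x, x ≠ y → η x = η' x) →
      |E j F η - E j F η'| ≤
        w y - (if V j y then w y else 0) + if ¬ V j y ∧ bd j y then M * w y else 0)
    (near : S → Prop)
    (hV : ∀ y, ¬ near y → n ≤ ((J.filter fun j => V j y).card : ℝ))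
    (hbd : ∀ y, M * ((J.filter fun j => ¬ V j y ∧ bd j y).card : ℝ) ≤ n / 2)
    {F : (S → Bool) → ℝ} (hF : HamLip w F) :
    |∑ η, q η * F η| ≤ 2 * A * ∑ x, if near x then w x else 0 := by
  set R := ∑ x, if near x then w x else 0 with hR
  set N : ℝ := J.card + n with hN
  have hNpos : 0 < N := by positivity
  set c : ℝ := n / (2 * N) with hc
  have hcpos : 0 < c := by positivity
  have hcN : c * N = n / 2 := by rw [hc]; field_simp
  have hc1 : c < 1 := by
    rw [hc, div_lt_one (by positivity)]
    have : (0 : ℝ) ≤ J.card := Nat.cast_nonneg _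
    linarith
  set Ws : Set ℝ := {a | ∃ F, HamLip w F ∧ a = |∑ η, q η * F η|} with hWs
  have hbddF : ∀ G, HamLip w G → |∑ η, q η * G η| ≤ A * ∑ x, w x := by
    intro G hG
    refine hq G _ fun η η' => (hG η η').trans (Finset.sum_le_sum fun x _ => ?_)
    split_ifs
    · exact le_rfl
    · exact hw x
  have hbddW : BddAbove Ws := ⟨A * ∑ x, w x, by rintro a ⟨G, hG, rfl⟩; exact hbddF G hG⟩
  have hle : ∀ G, HamLip w G → |∑ η, q η * G η| ≤ sSup Ws := fun G hG =>
    le_csSup hbddW ⟨G, hG, rfl⟩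
  have hstep : ∀ G, HamLip w G → |∑ η, q η * G η| ≤ (1 - c) * sSup Ws + A * (2 * c * R) := by
    intro G hG
    set TG : (S → Bool) → ℝ := fun η => G η + N⁻¹ * ∑ j ∈ J, (E j G η - G η) with hTG
    have hinv : ∑ η, q η * TG η = ∑ η, q η * G η := by
      have e1 : ∀ η, q η * TG η = q η * G η + N⁻¹ * ∑ j ∈ J, (q η * E j G η - q η * G η) := by
        intro η
        simp only [hTG, ← mul_sub, ← Finset.mul_sum]
        ring
      rw [Finset.sum_congr rfl fun η _ => e1 η, Finset.sum_add_distrib, ← Finset.mul_sum,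
        Finset.sum_comm, Finset.sum_eq_zero (s := J), mul_zero, add_zero]
      intro j hj
      rw [Finset.sum_sub_distrib, hE j hj, sub_self]
    have hTlip : HamLip (fun x => (1 - c) * w x + if near x then 2 * c * w x else 0) TG := by
      refine HamLip.of_single_site fun y η η' hηη' => ?_
      have hG1 : |G η - G η'| ≤ w y := by
        refine (hG η η').trans ?_
        rw [Finset.sum_eq_single y (fun x _ hx => by simp [hηη' x hx]) (by simp)]
        split_ifs
        · exact le_rfl
        · exact hw y
      have e2 : TG η - TG η' =
          N⁻¹ * (n * (G η - G η') + ∑ j ∈ J, (E j G η - E j G η')) := by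
        simp only [hTG, Finset.sum_sub_distrib, Finset.sum_const, nsmul_eq_mul]
        have : G η - G η' = N⁻¹ * ((J.card + n) * (G η - G η')) := by
          rw [← hN]; field_simp
        linear_combination this
      have hsumE : |∑ j ∈ J, (E j G η - E j G η')| ≤
          J.card * w y - (J.filter fun j => V j y).card * w y +
            (J.filter fun j => ¬ V j y ∧ bd j y).card * (M * w y) := by
        refine (Finset.abs_sum_le_sum_abs _ _).trans
          ((Finset.sum_le_sum fun j hj => hosc j hj G hG y η η' hηη').trans (le_of_eq ?_))
        rw [Finset.sum_add_distrib, Finset.sum_sub_distrib, ← Finset.sum_filter,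
          ← Finset.sum_filter]
        simp
      have hwy := hw y
      have hb := mul_le_mul_of_nonneg_right (hbd y) hwy
      rw [e2, abs_mul, abs_of_pos (inv_pos.2 hNpos), inv_mul_le_iff₀ hNpos]
      have h1 : |n * (G η - G η') + ∑ j ∈ J, (E j G η - E j G η')| ≤
          n * w y + |∑ j ∈ J, (E j G η - E j G η')| := by
        refine (abs_add_le _ _).trans ?_
        rw [abs_mul, abs_of_pos hn]
        gcongr
      by_cases hny : near y
      · have h0 : 0 ≤ ((J.filter fun j => V j y).card : ℝ) * w y := by positivity
        simp only [hny, if_true]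
        have : N * ((1 - c) * w y + 2 * c * w y) = N * w y + (c * N) * w y := by ring
        rw [this, hcN, hN]
        linarith
      · have h0 := mul_le_mul_of_nonneg_right (hV y hny) hwy
        simp only [hny, if_false]
        have : N * ((1 - c) * w y + 0) = N * w y - (c * N) * w y := by ring
        rw [this, hcN, hN]
        linarith
    obtain ⟨F₁, hF₁, hF₁'⟩ := HamLip.exists_approx
      (fun x => mul_nonneg (by linarith) (hw x))
      (fun x => by
        have := hw x
        split_ifs
        · positivity
        · exact le_rfl) hTlip
    have hU : (∑ x, if near x then 2 * c * w x else 0) = 2 * c * R := by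
      rw [hR, Finset.mul_sum]
      exact Finset.sum_congr rfl fun x _ => by split_ifs <;> simp
    rw [hU] at hF₁'
    have hF₂ : HamLip w fun η => (1 - c)⁻¹ * F₁ η := by
      intro η η'
      rw [← mul_sub, abs_mul, abs_of_pos (inv_pos.2 (by linarith)), inv_mul_le_iff₀ (by linarith),
        Finset.mul_sum]
      refine (hF₁ η η').trans (le_of_eq (Finset.sum_congr rfl fun x _ => ?_))
      split_ifs <;> simp
    have hA : |∑ η, q η * F₁ η| ≤ (1 - c) * sSup Ws := by
      have h := hle _ hF₂
      have e3 : ∑ η, q η * ((1 - c)⁻¹ * F₁ η) = (1 - c)⁻¹ * ∑ η, q η * F₁ η := by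
        rw [Finset.mul_sum]
        exact Finset.sum_congr rfl fun x _ => by ring
      rwa [e3, abs_mul, abs_of_pos (inv_pos.2 (by linarith)), inv_mul_le_iff₀ (by linarith)] at h
    have hB : |∑ η, q η * (TG η - F₁ η)| ≤ A * (2 * c * R) :=
      hq _ _ fun η η' => abs_le.2
        ⟨by linarith [hF₁' η, hF₁' η'], by linarith [hF₁' η, hF₁' η']⟩
    rw [← hinv]
    have e4 : ∑ η, q η * TG η = ∑ η, q η * F₁ η + ∑ η, q η * (TG η - F₁ η) := by
      rw [← Finset.sum_add_distrib]
      exact Finset.sum_congr rfl fun x _ => by ring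
    rw [e4]
    exact (abs_add_le _ _).trans (add_le_add hA hB)
  have hsup : sSup Ws ≤ (1 - c) * sSup Ws + A * (2 * c * R) :=
    csSup_le ⟨_, F, hF, rfl⟩ (by rintro a ⟨G, hG, rfl⟩; exact hstep G hG)
  have : c * sSup Ws ≤ c * (2 * A * R) := by linarith
  exact (hle F hF).trans (le_of_mul_le_mul_left this hcpos)

/-! ### Geometry of the lattice -/

lemma supD_le_iff {d : ℕ} {x y : ZLat d} {r : ℕ} :
    supD x y ≤ r ↔ ∀ k, (x k - y k).natAbs ≤ r := by
  simp [supD, Finset.sup_le_iff]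

lemma supD_self {d : ℕ} (x : ZLat d) : supD x x = 0 :=
  Nat.le_zero.1 (supD_le_iff.2 (by simp))

lemma supD_comm {d : ℕ} (x y : ZLat d) : supD x y = supD y x := by
  unfold supD
  congr 1
  funext k
  omega

lemma supD_triangle {d : ℕ} (x y u : ZLat d) : supD x u ≤ supD x y + supD y u := by
  rw [supD_le_iff]
  intro k
  have h1 := supD_le_iff.1 (le_refl (supD x y)) k
  have h2 := supD_le_iff.1 (le_refl (supD y u)) k
  omega

/-- The sup-metric ball of radius `r` around the site `x`. -/
def latBall {d : ℕ} (x : ZLat d) (r : ℕ) : Finset (ZLat d) :=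
  Fintype.piFinset fun k => Finset.Icc (x k - r) (x k + r)

lemma mem_latBall {d : ℕ} {x y : ZLat d} {r : ℕ} : y ∈ latBall x r ↔ supD x y ≤ r := by
  rw [latBall, Fintype.mem_piFinset, supD_le_iff]
  refine forall_congr' fun k => ?_
  rw [Finset.mem_Icc]
  omega

lemma card_latBall {d : ℕ} (x : ZLat d) (r : ℕ) : (latBall x r).card = (2 * r + 1) ^ d := by
  have : ∀ k, (x k + r + 1 - (x k - r)).toNat = 2 * r + 1 := fun k => by omega
  simp [latBall, Fintype.card_piFinset, this]

lemma fDist_comm {d : ℕ} (S T : Finset (ZLat d)) : fDist S T = fDist T S := by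
  unfold fDist
  congr 1
  ext a
  constructor <;>
  · rintro ⟨p, hp, rfl⟩
    exact ⟨p.swap, ⟨hp.2, hp.1⟩, by simp [supD_comm]⟩

lemma fDist_le {d : ℕ} {S T : Finset (ZLat d)} {x y : ZLat d} (hx : x ∈ S) (hy : y ∈ T) :
    fDist S T ≤ supD x y :=
  csInf_le ⟨0, by rintro _ ⟨p, -, rfl⟩; positivity⟩ ⟨(x, y), ⟨hx, hy⟩, rfl⟩

lemma le_fDist {d : ℕ} {S T : Finset (ZLat d)} {a : ℝ} (hS : S.Nonempty) (hT : T.Nonempty)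
    (h : ∀ x ∈ S, ∀ y ∈ T, a ≤ supD x y) : a ≤ fDist S T := by
  obtain ⟨x, hx⟩ := hS
  obtain ⟨y, hy⟩ := hT
  exact le_csInf ⟨_, (x, y), ⟨hx, hy⟩, rfl⟩ (by rintro _ ⟨p, hp, rfl⟩; exact h _ hp.1 _ hp.2)

lemma fDist_singleton_le_add {d : ℕ} (T : Finset (ZLat d)) (x y : ZLat d) :
    fDist {x} T ≤ fDist {y} T + supD x y := by
  rcases T.eq_empty_or_nonempty with rfl | hT
  · simp [fDist]
  have : fDist {x} T - supD x y ≤ fDist {y} T := by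
    refine le_fDist (Finset.singleton_nonempty y) hT fun u hu v hv => ?_
    rw [Finset.mem_singleton.1 hu]
    have h1 := fDist_le (Finset.mem_singleton_self x) hv
    have h2 : (supD x v : ℝ) ≤ supD x y + supD y v := by exact_mod_cast supD_triangle x y v
    linarith
  linarith

/-- The product of the smaller cardinality with the decay factor, for sets at distance at
least `k`, one of which has at most `c` points. -/
lemma min_card_mul_exp_le {d : ℕ} {S T : Finset (ZLat d)} {b c : ℝ} {k : ℕ} (hb : 0 < b)
    (hT : (T.card : ℝ) ≤ c) (h : ∀ x ∈ S, ∀ y ∈ T, k ≤ supD x y) :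
    (min S.card T.card : ℝ) * Real.exp (-b * fDist S T) ≤ c * Real.exp (-b * k) := by
  have hc : 0 ≤ c := (Nat.cast_nonneg _).trans hT
  rcases S.eq_empty_or_nonempty with rfl | hS
  · simp
    positivity
  rcases T.eq_empty_or_nonempty with rfl | hT'
  · simp
    positivity
  have hd : (k : ℝ) ≤ fDist S T := le_fDist hS hT' fun x hx y hy => by exact_mod_cast h x hx y hy
  refine mul_le_mul ((min_le_right _ _).trans hT) (Real.exp_le_exp.2 ?_) (Real.exp_pos _).le hc
  nlinarith

lemma cubesRegion_mono {d : ℕ} (ℓ : ℕ) {I I' : Finset (ZLat d)} (h : I ⊆ I') :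
    cubesRegion ℓ I ⊆ cubesRegion ℓ I' :=
  Finset.biUnion_subset_biUnion_of_subset_left _ h

lemma mem_cubesRegion_iff {d : ℕ} {ℓ : ℕ} (hℓ : 0 < ℓ) {I : Finset (ZLat d)} {x : ZLat d} :
    x ∈ cubesRegion ℓ I ↔ (fun k => x k / (ℓ : ℤ)) ∈ I := by
  have hℓ' : (0 : ℤ) < ℓ := by exact_mod_cast hℓ
  have : ∀ i : ZLat d, x ∈ cube ℓ i ↔ (fun k => x k / (ℓ : ℤ)) = i := by
    intro i
    rw [cube, Fintype.mem_piFinset, funext_iff]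
    refine forall_congr' fun k => ?_
    rw [Finset.mem_Ico]
    constructor
    · rintro ⟨h1, h2⟩
      refine le_antisymm (Int.lt_add_one_iff.1 (Int.ediv_lt_of_lt_mul hℓ' ?_))
        (Int.le_ediv_of_mul_le hℓ' ?_) <;> nlinarith
    · intro hk
      rw [← hk]
      have h1 := Int.mul_ediv_self_le (x := x k) (k := (ℓ : ℤ)) hℓ'.ne'
      have h2 := Int.lt_mul_ediv_self_add (x := x k) hℓ'
      exact ⟨h1, h2⟩
  simp [cubesRegion, this]

lemma card_cube {d : ℕ} (ℓ : ℕ) (i : ZLat d) : (cube ℓ i).card = ℓ ^ d := by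
  simp [cube, Fintype.card_piFinset]

lemma card_cubesRegion_le {d : ℕ} (ℓ : ℕ) (I : Finset (ZLat d)) :
    (cubesRegion ℓ I).card ≤ I.card * ℓ ^ d :=
  Finset.card_biUnion_le_card_mul _ _ _ fun i _ => (card_cube ℓ i).le

/-! ### Finite-range potentials -/

/-- The potential `Φ` is local and has range at most `r`. -/
def HasRange {d : ℕ} (Φ : Finset (ZLat d) → GConf d → ℝ) (r : ℕ) : Prop :=
  (∀ X, LocalOn (Φ X) X) ∧ ∀ X : Finset (ZLat d), ∀ x ∈ X, ∀ y ∈ X, r < supD x y → Φ X = 0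

lemma hasRange_gasPot {d : ℕ} (G : LatticeGas d) (zf : ZLat d → ℝ) :
    HasRange (gasPot G zf) G.r := by
  refine ⟨fun X σ τ h => ?_, fun X x hx y hy hxy => ?_⟩
  · unfold gasPot
    split_ifs
    · exact Finset.sum_congr rfl fun x hx => by rw [h x hx]
    · exact G.Ulocal X σ τ h
  · funext σ
    unfold gasPot
    split_ifs with hX
    · obtain ⟨a, rfl⟩ := Finset.card_eq_one.1 hX
      rw [Finset.mem_singleton.1 hx, Finset.mem_singleton.1 hy, supD_self] at hxy
      omega
    · rw [G.Urange X x hx y hy hxy]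

/-- The configuration equal to `ζ` in `V` and to `ξ` outside `V`. -/
def patch {d : ℕ} (V : Finset (ZLat d)) (ζ ξ : GConf d) : GConf d :=
  fun x => if x ∈ V then ζ x else ξ x

lemma patch_override_self {d : ℕ} (V : Finset (ZLat d)) (σ : ↥V → Bool) (ξ ξ' : GConf d) :
    patch V (override V σ ξ) ξ' = override V σ ξ' := by
  funext x
  by_cases hx : x ∈ V <;> simp [patch, override, hx]

/-- All the sets which contribute to the Hamiltonian of range `r` in `V`. -/
def interSets {d : ℕ} (V : Finset (ZLat d)) (r : ℕ) : Finset (Finset (ZLat d)) :=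
  (V.biUnion fun x => latBall x r).powerset

lemma interSets_mono {d : ℕ} {V W : Finset (ZLat d)} (h : V ⊆ W) (r : ℕ) :
    interSets V r ⊆ interSets W r :=
  Finset.powerset_mono.2 (Finset.biUnion_subset_biUnion_of_subset_left _ h)

lemma HasRange.hamil_eq {d : ℕ} {Φ : Finset (ZLat d) → GConf d → ℝ} {r : ℕ} (h : HasRange Φ r)
    {V : Finset (ZLat d)} {P : Finset (Finset (ZLat d))} (hP : interSets V r ⊆ P)
    (ξ : GConf d) :
    hamil Φ V ξ = ∑ X ∈ P, if (X ∩ V).Nonempty then Φ X ξ else 0 := by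
  refine tsum_eq_sum fun X hX => ?_
  split_ifs with hXV
  · obtain ⟨x, hx⟩ := hXV
    rw [Finset.mem_inter] at hx
    have hX' : X ∉ interSets V r := fun h' => hX (hP h')
    rw [interSets, Finset.mem_powerset, Finset.not_subset] at hX'
    obtain ⟨y, hy, hy'⟩ := hX'
    have : r < supD x y := by
      by_contra hlt
      exact hy' (Finset.mem_biUnion.2 ⟨x, hx.2, mem_latBall.2 (not_lt.1 hlt)⟩)
    rw [h.2 X x hx.1 y hy this, Pi.zero_apply]
  · rfl

lemma HasRange.hamil_sub_hamil {d : ℕ} {Φ : Finset (ZLat d) → GConf d → ℝ} {r : ℕ}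
    (h : HasRange Φ r) {V Λ : Finset (ZLat d)} (hV : V ⊆ Λ) {ξ ξ' : GConf d}
    (hξ : ∀ x, x ∉ V → ξ x = ξ' x) :
    hamil Φ Λ ξ - hamil Φ V ξ = hamil Φ Λ ξ' - hamil Φ V ξ' := by
  simp only [h.hamil_eq (Finset.Subset.refl (interSets Λ r)), h.hamil_eq (interSets_mono hV r),
    ← Finset.sum_sub_distrib]
  refine Finset.sum_congr rfl fun X _ => ?_
  by_cases hXV : (X ∩ V).Nonempty
  · have : (X ∩ Λ).Nonempty := hXV.mono (Finset.inter_subset_inter_left hV)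
    simp [hXV, this]
  · have : Φ X ξ = Φ X ξ' := by
      refine h.1 X _ _ fun x hx => hξ x fun hxV => hXV ⟨x, Finset.mem_inter.2 ⟨hx, hxV⟩⟩
    rw [this]

lemma HasRange.hamil_congr_of_far {d : ℕ} {Φ : Finset (ZLat d) → GConf d → ℝ} {r : ℕ}
    (h : HasRange Φ r) {V : Finset (ZLat d)} {y : ZLat d} (hy : ∀ x ∈ V, r < supD x y)
    {ξ ξ' : GConf d} (hξ : ∀ x, x ≠ y → ξ x = ξ' x) :
    hamil Φ V ξ = hamil Φ V ξ' := by
  unfold hamil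
  congr 1
  funext X
  split_ifs with hXV
  · obtain ⟨x, hx⟩ := hXV
    rw [Finset.mem_inter] at hx
    by_cases hyX : y ∈ X
    · rw [h.2 X x hx.1 y hyX (hy x hx.2)]
      rfl
    · exact h.1 X _ _ fun u hu => hξ u fun e => hyX (e ▸ hu)
  · rfl

/-- The change of energy caused by a change of the boundary condition at `y` only depends on the
configuration near `y`. -/
lemma HasRange.localOn_hamil_patch_sub {d : ℕ} {Φ : Finset (ZLat d) → GConf d → ℝ} {r : ℕ}
    (h : HasRange Φ r) (V : Finset (ZLat d)) {y : ZLat d}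
    {ξ ξ' : GConf d} (hξ : ∀ x, x ≠ y → ξ x = ξ' x) :
    LocalOn (fun ζ => hamil Φ V (patch V ζ ξ') - hamil Φ V (patch V ζ ξ)) (V ∩ latBall y r) := by
  intro ζ ζ' hζ
  simp only [h.hamil_eq (Finset.Subset.refl (interSets V r)), ← Finset.sum_sub_distrib]
  refine Finset.sum_congr rfl fun X _ => ?_
  split_ifs with hXV
  · by_cases hyX : y ∈ X
    · by_cases hX : X ⊆ latBall y r
      · have : ∀ τ, Φ X (patch V ζ τ) = Φ X (patch V ζ' τ) := by
          intro τ
          refine h.1 X _ _ fun x hx => ?_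
          by_cases hxV : x ∈ V
          · simp [patch, hxV, hζ x (Finset.mem_inter.2 ⟨hxV, hX hx⟩)]
          · simp [patch, hxV]
        rw [this, this]
      · obtain ⟨x, hx, hx'⟩ := Finset.not_subset.1 hX
        rw [mem_latBall, not_le] at hx'
        simp [h.2 X y hyX x hx hx']
    · have : ∀ ω : GConf d, Φ X (patch V ω ξ') = Φ X (patch V ω ξ) := by
        intro ω
        refine h.1 X _ _ fun x hx => ?_
        have hxy : x ≠ y := fun e => hyX (e ▸ hx)
        simp [patch, hξ x hxy]
      rw [this, this, sub_self, sub_self]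
  · rfl

/-- A translation invariant finite-range interaction is uniformly bounded. -/
lemma LatticeGas.exists_bound {d : ℕ} (G : LatticeGas d) :
    ∃ K : ℝ, 0 ≤ K ∧ ∀ X σ, |G.U X σ| ≤ K := by
  have hloc : ∀ X : Finset (ZLat d), ∃ C : ℝ, 0 ≤ C ∧ ∀ σ, |G.U X σ| ≤ C := by
    intro X
    refine ⟨∑ s : ↥X → Bool, |G.U X (override X s fun _ => false)|, by positivity, fun σ => ?_⟩
    have : G.U X σ = G.U X (override X (fun x => σ x) fun _ => false) :=
      G.Ulocal X _ _ fun x hx => by simp [override, hx]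
    rw [this]
    exact Finset.single_le_sum (f := fun s : ↥X → Bool => |G.U X (override X s fun _ => false)|)
      (fun _ _ => abs_nonneg _) (Finset.mem_univ _)
  choose C hC0 hC using hloc
  refine ⟨∑ X ∈ (latBall (0 : ZLat d) G.r).powerset, C X,
    Finset.sum_nonneg fun X _ => hC0 X, fun X σ => ?_⟩
  have hpos : 0 ≤ ∑ X ∈ (latBall (0 : ZLat d) G.r).powerset, C X :=
    Finset.sum_nonneg fun X _ => hC0 X
  rcases X.eq_empty_or_nonempty with rfl | ⟨x, hx⟩
  · simpa [G.Upair ∅ (by simp)] using hpos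
  by_cases hX : ∀ y ∈ X, supD x y ≤ G.r
  · set Y := X.image (· + -x) with hY
    have hXY : X = Y.image (· + x) := by
      rw [hY, Finset.image_image]
      ext u
      simp
    have hYb : Y ⊆ latBall 0 G.r := by
      intro u hu
      obtain ⟨v, hv, rfl⟩ := Finset.mem_image.1 hu
      rw [mem_latBall, supD_le_iff]
      intro k
      have := supD_le_iff.1 (hX v hv) k
      simp only [Pi.zero_apply, Pi.add_apply, Pi.neg_apply]
      omega
    rw [hXY, G.UtransInv]
    exact (hC Y _).trans
      (Finset.single_le_sum (fun X _ => hC0 X) (Finset.mem_powerset.2 hYb))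
  · push Not at hX
    obtain ⟨y, hy, hxy⟩ := hX
    simpa [G.Urange X x hx y hy hxy] using hpos

/-- The energy changes by a bounded amount when the boundary condition changes at one site. -/
lemma abs_hamil_sub_le_of_single_site {d : ℕ} (G : LatticeGas d) {K : ℝ}
    (hK : ∀ X σ, |G.U X σ| ≤ K) (zf : ZLat d → ℝ)
    {V : Finset (ZLat d)} {y : ZLat d} (hy : y ∉ V) {ξ ξ' : GConf d}
    (hξ : ∀ x, x ≠ y → ξ x = ξ' x) :
    |hamil (gasPot G zf) V ξ' - hamil (gasPot G zf) V ξ| ≤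
      2 ^ ((2 * G.r + 1) ^ d) * (2 * K) := by
  have h := hasRange_gasPot G zf
  have hK0 : 0 ≤ K := (abs_nonneg _).trans (hK ∅ ξ)
  rw [h.hamil_eq (P := interSets V G.r ∪ (latBall y G.r).powerset) Finset.subset_union_left,
    h.hamil_eq (P := interSets V G.r ∪ (latBall y G.r).powerset) Finset.subset_union_left,
    ← Finset.sum_sub_distrib]
  calc _ ≤ ∑ X ∈ interSets V G.r ∪ (latBall y G.r).powerset,
        (if X ∈ (latBall y G.r).powerset then 2 * K else 0) := by
        refine (Finset.abs_sum_le_sum_abs _ _).trans (Finset.sum_le_sum fun X _ => ?_)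
        by_cases hXV : (X ∩ V).Nonempty
        swap
        · simp only [hXV, if_false, sub_self, abs_zero]
          split_ifs <;> positivity
        simp only [hXV, if_true]
        by_cases hyX : y ∈ X
        · by_cases hX : X ⊆ latBall y G.r
          · have hcard : X.card ≠ 1 := by
              intro h1
              obtain ⟨a, rfl⟩ := Finset.card_eq_one.1 h1
              obtain ⟨x, hx⟩ := hXV
              rw [Finset.mem_inter, Finset.mem_singleton] at hx
              rw [Finset.mem_singleton] at hyX
              exact hy (by rw [hyX, ← hx.1]; exact hx.2)
            simp only [Finset.mem_powerset, hX, if_true, gasPot, hcard, if_false]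
            refine (abs_sub _ _).trans ?_
            linarith [hK X ξ, hK X ξ']
          · obtain ⟨x, hx, hx'⟩ := Finset.not_subset.1 hX
            rw [mem_latBall, not_le] at hx'
            simp [h.2 X y hyX x hx hx', hX]
        · have : gasPot G zf X ξ' = gasPot G zf X ξ :=
            h.1 X _ _ fun x hx => (hξ x fun e => hyX (e ▸ hx)).symm
          rw [this, sub_self, abs_zero]
          split_ifs <;> positivity
    _ = _ := by
        rw [← Finset.sum_filter, Finset.filter_mem_eq_inter, Finset.union_inter_cancel_right,
          Finset.sum_const, Finset.card_powerset, card_latBall, nsmul_eq_mul]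
        push_cast
        ring

/-- Comparison of the energies for two families of activities. -/
lemma abs_hamil_sub_le_of_activity {d : ℕ} (G : LatticeGas d) (zf zf' : ZLat d → ℝ) {s : ℝ}
    (hs : ∀ x, |Real.log (zf x) - Real.log (zf' x)| ≤ s) (V : Finset (ZLat d)) (ξ : GConf d) :
    |hamil (gasPot G zf) V ξ - hamil (gasPot G zf') V ξ| ≤ V.card * s := by
  have hs0 : 0 ≤ s := (abs_nonneg _).trans (hs 0)
  set P := interSets V G.r ∪ V.image fun x => ({x} : Finset (ZLat d)) with hP
  rw [(hasRange_gasPot G zf).hamil_eq (P := P) Finset.subset_union_left,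
    (hasRange_gasPot G zf').hamil_eq (P := P) Finset.subset_union_left,
    ← Finset.sum_sub_distrib]
  calc _ ≤ ∑ X ∈ P, (if X ∈ V.image fun x => ({x} : Finset (ZLat d)) then s else 0) := by
        refine (Finset.abs_sum_le_sum_abs _ _).trans (Finset.sum_le_sum fun X _ => ?_)
        by_cases hXV : (X ∩ V).Nonempty
        swap
        · simp only [hXV, if_false, sub_self, abs_zero]
          split_ifs <;> positivity
        simp only [hXV, if_true, gasPot]
        by_cases hX : X.card = 1
        · obtain ⟨a, rfl⟩ := Finset.card_eq_one.1 hX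
          obtain ⟨x, hx⟩ := hXV
          rw [Finset.mem_inter, Finset.mem_singleton] at hx
          have ha : a ∈ V := hx.1 ▸ hx.2
          simp only [Finset.card_singleton, if_true, Finset.sum_singleton, Finset.mem_image,
            Finset.singleton_inj, exists_eq_right, ha]
          split_ifs
          · exact hs a
          · simpa using hs0
        · simp only [hX, if_false, sub_self, abs_zero]
          split_ifs <;> positivity
    _ = _ := by
        rw [← Finset.sum_filter, Finset.filter_mem_eq_inter, hP, Finset.union_inter_cancel_right,
          Finset.sum_const, Finset.card_image_of_injective _ Finset.singleton_injective,
          nsmul_eq_mul]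

/-! ### Finite-volume Gibbs averages -/

lemma gibbsExp_eq_wAvg {d : ℕ} (Φ : Finset (ZLat d) → GConf d → ℝ) (V : Finset (ZLat d))
    (τ : GConf d) (f : GConf d → ℝ) :
    gibbsExp Φ V τ f = wAvg (fun σ => Real.exp (hamil Φ V (override V σ τ)))
      (fun σ => f (override V σ τ)) := rfl

lemma LocalOn.abs_le_supNorm {d : ℕ} {f : GConf d → ℝ} {S : Finset (ZLat d)} (hf : LocalOn f S)
    (σ : GConf d) : |f σ| ≤ supNorm f := by
  refine le_ciSup (f := fun a => |f a|) ⟨∑ s : ↥S → Bool, |f (override S s fun _ => false)|, ?_⟩ σ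
  rintro _ ⟨τ, rfl⟩
  have : f τ = f (override S (fun x => τ x) fun _ => false) :=
    hf _ _ fun x hx => by simp [override, hx]
  simp only [this]
  exact Finset.single_le_sum (f := fun s : ↥S → Bool => |f (override S s fun _ => false)|)
    (fun _ _ => abs_nonneg _) (Finset.mem_univ _)

lemma supNorm_nonneg {α : Type*} (f : α → ℝ) : 0 ≤ supNorm f :=
  Real.iSup_nonneg fun _ => abs_nonneg _

lemma supNorm_le {α : Type*} [Nonempty α] {f : α → ℝ} {u : ℝ} (h : ∀ a, |f a| ≤ u) :
    supNorm f ≤ u :=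
  ciSup_le h

lemma sum_indicator_le {A : Type*} [DecidableEq A] (Λ T : Finset A) {c : ℝ} (hc : 0 ≤ c) :
    (∑ x ∈ Λ, if x ∈ T then c else 0) ≤ T.card * c := by
  rw [← Finset.sum_filter, Finset.sum_const, nsmul_eq_mul]
  gcongr
  intro x hx
  exact (Finset.mem_filter.1 hx).2

/-- Strong mixing bounds the effect of a single boundary spin on a distant observable. -/
lemma SM.abs_gibbsExp_sub_le {d : ℕ} {G : LatticeGas d} {ℓ0 : ℕ} {b B K : ℝ}
    (hb : 0 < b) (hB : 0 < B) (hSM : SM (gasPotH G) ℓ0 b B) (hK : ∀ X σ, |G.U X σ| ≤ K)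
    {k : ℕ} (hk : ((2 * G.r + 1 : ℕ) : ℝ) ^ d * Real.exp (-b * k) ≤ 1)
    (I : Finset (ZLat d)) {y : ZLat d} (hy : y ∉ cubesRegion ℓ0 I) {ξ ξ' : GConf d}
    (hξ : ∀ x, x ≠ y → ξ x = ξ' x) {F : GConf d → ℝ} {S : Finset (ZLat d)}
    (hF : LocalOn F S) (hS : S ⊆ cubesRegion ℓ0 I) (hSy : ∀ x ∈ S, k + G.r < supD y x)
    {u : ℝ} (hu : ∀ σ, |F σ| ≤ u) :
    |gibbsExp (gasPotH G) (cubesRegion ℓ0 I) ξ' F - gibbsExp (gasPotH G) (cubesRegion ℓ0 I) ξ F| ≤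
      B * Real.exp (2 * (2 ^ ((2 * G.r + 1) ^ d) * (2 * K))) * ((2 * G.r + 1 : ℕ) : ℝ) ^ d *
        Real.exp (-b * k) * u := by
  set V := cubesRegion ℓ0 I with hVdef
  set T := 2 ^ ((2 * G.r + 1) ^ d) * (2 * K) with hT
  set h : GConf d → ℝ := fun ζ =>
    Real.exp (hamil (gasPotH G) V (patch V ζ ξ') - hamil (gasPotH G) V (patch V ζ ξ)) with hh
  have hr : HasRange (gasPotH G) G.r := hasRange_gasPot G _
  have hloc : LocalOn h (V ∩ latBall y G.r) := fun ζ ζ' hζ =>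
    congrArg Real.exp (hr.localOn_hamil_patch_sub V hξ ζ ζ' hζ)
  have hlog : ∀ ζ, |hamil (gasPotH G) V (patch V ζ ξ') - hamil (gasPotH G) V (patch V ζ ξ)| ≤ T :=
    fun ζ => abs_hamil_sub_le_of_single_site G hK _ hy fun x hx => by simp [patch, hξ x hx]
  have hup : ∀ ζ, |h ζ| ≤ Real.exp T := fun ζ => by
    rw [abs_of_pos (Real.exp_pos _)]
    exact Real.exp_le_exp.2 (abs_le.1 (hlog ζ)).2
  have hlow : ∀ ζ, Real.exp (-T) ≤ h ζ := fun ζ => Real.exp_le_exp.2 (abs_le.1 (hlog ζ)).1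
  have hm : ∀ σ : ↥V → Bool, 0 < Real.exp (hamil (gasPotH G) V (override V σ ξ)) :=
    fun _ => Real.exp_pos _
  have e1 : gibbsExp (gasPotH G) V ξ' F =
      wAvg (fun σ => Real.exp (hamil (gasPotH G) V (override V σ ξ)) * h (override V σ ξ))
        (fun σ => F (override V σ ξ)) := by
    rw [gibbsExp_eq_wAvg]
    congr 1
    · funext σ
      rw [hh]
      simp only [patch_override_self]
      rw [← Real.exp_add]
      congr 1
      ring
    · funext σ
      exact hF _ _ fun x hx => by simp [override, hS hx]
  rw [e1, gibbsExp_eq_wAvg,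
    wAvg_tilt_sub _ hm fun σ => Real.exp_pos _]
  have hcard : ((V ∩ latBall y G.r).card : ℝ) ≤ ((2 * G.r + 1 : ℕ) : ℝ) ^ d := by
    rw [← Nat.cast_pow, ← card_latBall y G.r]
    exact_mod_cast Finset.card_le_card Finset.inter_subset_right
  have hmin := min_card_mul_exp_le (S := S) hb hcard (k := k) fun x hx v hv => by
    have h1 := hSy x hx
    have h2 := mem_latBall.1 (Finset.mem_inter.1 hv).2
    have h3 := supD_triangle y v x
    rw [supD_comm v x] at h3
    omega
  have hcov := hSM I F h S (V ∩ latBall y G.r) hF hloc hS Finset.inter_subset_left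
    (hmin.trans hk) ξ
  simp only [gibbsExp_eq_wAvg] at hcov
  have hden : Real.exp (-T) ≤
      wAvg (fun σ => Real.exp (hamil (gasPotH G) V (override V σ ξ)))
        (fun σ => h (override V σ ξ)) := le_wAvg hm fun σ => hlow _
  have hden0 := (Real.exp_pos (-T)).trans_le hden
  have hu0 : 0 ≤ u := (abs_nonneg _).trans (hu ξ)
  rw [abs_div, abs_of_pos hden0, div_le_iff₀ hden0]
  refine hcov.trans ?_
  have hexp : Real.exp (2 * T) * Real.exp (-T) = Real.exp T := by
    rw [← Real.exp_add]; ring_nf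
  calc _ = B * supNorm F * supNorm h * ((min (S.card : ℝ) (V ∩ latBall y G.r).card) *
        Real.exp (-b * fDist S (V ∩ latBall y G.r))) := by ring
    _ ≤ B * u * Real.exp T * (((2 * G.r + 1 : ℕ) : ℝ) ^ d * Real.exp (-b * k)) := by
        have := supNorm_nonneg F
        have := supNorm_nonneg h
        have h1 := supNorm_le hu
        have h2 := supNorm_le hup
        gcongr
    _ = B * Real.exp (2 * T) * ((2 * G.r + 1 : ℕ) : ℝ) ^ d * Real.exp (-b * k) * u *
          Real.exp (-T) := by
        rw [← hexp]; ring
    _ ≤ _ := mul_le_mul_of_nonneg_left hden (by positivity)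

/-- Effect of a single boundary spin on the block averages of the perturbed potential. -/
lemma SM.abs_gibbsExp_perturbed_sub_le {d : ℕ} {G : LatticeGas d} {ℓ0 : ℕ} {b B K : ℝ}
    (hb : 0 < b) (hB : 0 < B) (hSM : SM (gasPotH G) ℓ0 b B) (hK : ∀ X σ, |G.U X σ| ≤ K)
    {k : ℕ} (hk : ((2 * G.r + 1 : ℕ) : ℝ) ^ d * Real.exp (-b * k) ≤ 1)
    {zf : ZLat d → ℝ} {s : ℝ} (hs : ∀ x, |Real.log (zf x) - Real.log G.z| ≤ s)
    {I Λ : Finset (ZLat d)} {nV : ℝ}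
    (hnV : ((cubesRegion ℓ0 I).card : ℝ) ≤ nV)
    {y : ZLat d} (hy : y ∉ cubesRegion ℓ0 I)
    {ξ ξ' : GConf d} (hξ : ∀ x, x ≠ y → ξ x = ξ' x)
    {w : ZLat d → ℝ} (hwy : 0 ≤ w y) (hw : ∀ x ∈ cubesRegion ℓ0 I, w x ≤ 2 * w y)
    {F : GConf d → ℝ}
    (hF : ∀ σ σ' : GConf d, |F σ - F σ'| ≤ ∑ x ∈ Λ, if σ x ≠ σ' x then w x else 0) :
    |gibbsExp (gasPot G zf) (cubesRegion ℓ0 I) ξ F -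
        gibbsExp (gasPot G zf) (cubesRegion ℓ0 I) ξ' F| ≤
      w y + (4 * ((2 * (k + G.r) + 1 : ℕ) : ℝ) ^ d + (4 * (Real.exp (2 * (nV * s)) - 1) +
        2 * (B * Real.exp (2 * (2 ^ ((2 * G.r + 1) ^ d) * (2 * K))) *
          ((2 * G.r + 1 : ℕ) : ℝ) ^ d * Real.exp (-b * k))) * nV) * w y := by
  set V := cubesRegion ℓ0 I with hVdef
  set D := B * Real.exp (2 * (2 ^ ((2 * G.r + 1) ^ d) * (2 * K))) *
          ((2 * G.r + 1 : ℕ) : ℝ) ^ d * Real.exp (-b * k) with hD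
  set n : ℝ := ((2 * (k + G.r) + 1 : ℕ) : ℝ) ^ d with hn
  have hs0 : 0 ≤ s := (abs_nonneg _).trans (hs 0)
  have hnV0 : 0 ≤ nV := (Nat.cast_nonneg _).trans hnV
  set W := V \ latBall y (k + G.r) with hW
  set F₁ : GConf d → ℝ := fun ζ => F (patch W ζ ξ) - F ξ with hF₁
  have hWV : W ⊆ V := Finset.sdiff_subset
  have hF₁loc : LocalOn F₁ W := fun ζ ζ' hζ => by
    have : patch W ζ ξ = patch W ζ' ξ := by
      funext x
      by_cases hx : x ∈ W
      · simp [patch, hx, hζ x hx]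
      · simp [patch, hx]
    simp only [hF₁, this]
  have hu : ∀ ζ, |F₁ ζ| ≤ nV * (2 * w y) := by
    intro ζ
    refine (hF _ _).trans ((Finset.sum_le_sum fun x _ => ?_).trans
      ((sum_indicator_le Λ V (by positivity : 0 ≤ 2 * w y)).trans (by gcongr)))
    by_cases hx : x ∈ V
    · simp only [hx, if_true]
      split_ifs
      · exact hw x hx
      · positivity
    · have : x ∉ W := fun h => hx (hWV h)
      simp [patch, this, hx]
  have hcut : ∀ τ : GConf d, ∀ c : ℝ, 0 ≤ c → (∀ x, x ≠ y → ξ x = τ x) →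
      (ξ y ≠ τ y → w y ≤ c) → ∀ σ : ↥V → Bool,
      |F (override V σ τ) - (F₁ (override V σ τ) + F ξ)| ≤ c + n * (2 * w y) := by
    intro τ c hc hτ hyc σ
    have e : F₁ (override V σ τ) + F ξ = F (patch W (override V σ τ) ξ) := by
      simp only [hF₁]; ring
    rw [e]
    refine (hF _ _).trans ?_
    have h1 : (∑ x ∈ Λ, if x ∈ ({y} : Finset (ZLat d)) then c else 0) ≤ c := by
      simpa using sum_indicator_le Λ ({y} : Finset (ZLat d)) hc
    have h2 := sum_indicator_le Λ (latBall y (k + G.r)) (by positivity : 0 ≤ 2 * w y)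
    rw [card_latBall, Nat.cast_pow, ← hn] at h2
    refine le_trans ?_ (add_le_add h1 h2)
    rw [← Finset.sum_add_distrib]
    refine Finset.sum_le_sum fun x _ => ?_
    by_cases hxy : x = y
    · subst hxy
      have : x ∉ W := fun h => hy (hWV h)
      simp only [patch, override, hy, this, if_false, dif_neg, not_false_iff, Finset.mem_singleton,
        if_true]
      have h3 : (0 : ℝ) ≤ if x ∈ latBall x (k + G.r) then 2 * w x else 0 := by
        split_ifs <;> positivity
      split_ifs with h4 <;> first | linarith [hyc (Ne.symm h4)] | linarith
    · simp only [Finset.mem_singleton, hxy, if_false, zero_add]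
      by_cases hxW : x ∈ W
      · simp only [patch, hxW, if_true, ne_eq, not_true, if_false]
        split_ifs <;> positivity
      · by_cases hxV : x ∈ V
        · have hxb : x ∈ latBall y (k + G.r) := by
            by_contra h
            exact hxW (Finset.mem_sdiff.2 ⟨hxV, h⟩)
          simp only [hxb, if_true]
          split_ifs
          · exact hw x hxV
          · positivity
        · simp only [patch, override, hxV, hxW, dif_neg, not_false_iff, if_false, hτ x hxy,
            ne_eq, not_true]
          split_ifs <;> positivity
  have hcmp : ∀ τ : GConf d, ∀ c : ℝ, 0 ≤ c → (∀ x, x ≠ y → ξ x = τ x) →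
      (ξ y ≠ τ y → w y ≤ c) →
      |gibbsExp (gasPot G zf) V τ F - (gibbsExp (gasPotH G) V τ F₁ + F ξ)| ≤
        c + n * (2 * w y) + (Real.exp (2 * (nV * s)) - 1) * (nV * (2 * w y)) := by
    intro τ c hc hτ hyc
    have hm : ∀ σ : ↥V → Bool, 0 < Real.exp (hamil (gasPot G zf) V (override V σ τ)) :=
      fun _ => Real.exp_pos _
    have h1 := abs_wAvg_sub_le hm (hcut τ c hc hτ hyc)
    rw [wAvg_add_const hm] at h1
    have h2 := abs_wAvg_exp_sub_le (t := nV * s)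
      (H := fun σ : ↥V → Bool => hamil (gasPotH G) V (override V σ τ))
      (H' := fun σ : ↥V → Bool => hamil (gasPot G zf) V (override V σ τ))
      (fun σ => (abs_hamil_sub_le_of_activity G zf _ hs V _).trans (by gcongr))
      (fun σ => hu (override V σ τ))
    simp only [gibbsExp_eq_wAvg]
    rw [abs_le] at h1 h2 ⊢
    constructor <;> linarith [h1.1, h1.2, h2.1, h2.2]
  have h1 := hcmp ξ 0 le_rfl (fun _ _ => rfl) (fun h => absurd rfl h)
  have h2 := hcmp ξ' (w y) hwy hξ (fun _ => le_rfl)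
  have h3 := hSM.abs_gibbsExp_sub_le hb hB hK hk I hy hξ hF₁loc hWV (fun x hx => by
    have := (Finset.mem_sdiff.1 hx).2
    rwa [mem_latBall, not_le] at this) hu
  rw [← hVdef, ← hD] at h3
  rw [abs_le] at h1 h2 h3 ⊢
  constructor <;> linarith [h1.1, h1.2, h2.1, h2.2, h3.1, h3.2]

/-! ### Reversibility of block averages -/

/-- The configuration equal to `σ` in `V` and to `η` in `Λ \ V`. -/
def blockUpdate {d : ℕ} {V Λ : Finset (ZLat d)} (η : ↥Λ → Bool) (σ : ↥V → Bool) : ↥Λ → Bool :=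
  fun x => if h : x.1 ∈ V then σ ⟨x, h⟩ else η x

/-- Block averages in `V ⊆ Λ` preserve Gibbs averages in `Λ` against observables that do not
depend on the configuration in `V`. -/
lemma sum_mul_gibbsExp_eq {d : ℕ} {Φ : Finset (ZLat d) → GConf d → ℝ} {r : ℕ}
    (hΦ : HasRange Φ r) {V Λ : Finset (ZLat d)} (hV : V ⊆ Λ) (τ : GConf d)
    {g : (↥Λ → Bool) → ℝ} (hg : ∀ η η' : ↥Λ → Bool, (∀ x, x.1 ∉ V → η x = η' x) → g η = g η')
    (F : (↥Λ → Bool) → ℝ) :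
    ∑ η : ↥Λ → Bool, Real.exp (hamil Φ Λ (override Λ η τ)) *
        (g η * gibbsExp Φ V (override Λ η τ) fun σ => F fun x => σ x) =
      ∑ η : ↥Λ → Bool, Real.exp (hamil Φ Λ (override Λ η τ)) * (g η * F η) := by
  set p : (↥Λ → Bool) → ℝ := fun η => Real.exp (hamil Φ Λ (override Λ η τ)) with hp
  set Z : (↥Λ → Bool) → ℝ := fun η => ∑ σ : ↥V → Bool, p (blockUpdate η σ) with hZ
  have hZpos : ∀ η, 0 < Z η := fun η => sum_weight_pos fun _ => Real.exp_pos _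
  have hoff : ∀ η (σ : ↥V → Bool) (x : ↥Λ), x.1 ∉ V → blockUpdate η σ x = η x :=
    fun η σ x hx => by simp [blockUpdate, hx]
  have hupd : ∀ (η : ↥Λ → Bool) (σ σ' : ↥V → Bool),
      blockUpdate (blockUpdate η σ) σ' = blockUpdate η σ' := by
    intro η σ σ'
    funext x
    by_cases hx : x.1 ∈ V <;> simp [blockUpdate, hx]
  have hov : ∀ (η : ↥Λ → Bool) (σ : ↥V → Bool),
      override V σ (override Λ η τ) = override Λ (blockUpdate η σ) τ := by
    intro η σ
    funext x
    by_cases hx : x ∈ V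
    · simp [override, blockUpdate, hx, hV hx]
    · by_cases hxΛ : x ∈ Λ <;> simp [override, blockUpdate, hx, hxΛ]
  have hgibbs : ∀ η : ↥Λ → Bool, (gibbsExp Φ V (override Λ η τ) fun σ => F fun x => σ x) =
      (∑ σ : ↥V → Bool, p (blockUpdate η σ) * F (blockUpdate η σ)) / Z η := by
    intro η
    set c := Real.exp (hamil Φ V (override Λ η τ) - hamil Φ Λ (override Λ η τ)) with hc
    have hw : ∀ σ : ↥V → Bool, Real.exp (hamil Φ V (override V σ (override Λ η τ))) =
        c * p (blockUpdate η σ) := by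
      intro σ
      have h := hΦ.hamil_sub_hamil hV (ξ := override Λ (blockUpdate η σ) τ)
        (ξ' := override Λ η τ) fun x hx => by
          by_cases hxΛ : x ∈ Λ <;> simp [override, blockUpdate, hx, hxΛ]
      rw [hov, hc, hp, ← Real.exp_add]
      congr 1
      linarith
    have hcpos : 0 < c := Real.exp_pos _
    have hres : ∀ σ : ↥V → Bool, (fun x : ↥Λ => override V σ (override Λ η τ) x) =
        blockUpdate η σ := by
      intro σ
      funext x
      rw [hov]
      simp [override]
    unfold gibbsExp partFun
    simp only [hw, hres, mul_assoc, ← Finset.mul_sum]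
    rw [mul_div_mul_left _ _ hcpos.ne']
  have hinv : Function.Involutive fun a : (↥Λ → Bool) × (↥V → Bool) =>
      ((blockUpdate a.1 a.2, fun x => a.1 ⟨x, hV x.2⟩) : (↥Λ → Bool) × (↥V → Bool)) := by
    rintro ⟨η, σ⟩
    refine Prod.ext ?_ ?_
    · funext x
      by_cases hx : x.1 ∈ V <;> simp [blockUpdate, hx]
    · funext x
      simp [blockUpdate]
  calc _ = ∑ a : (↥Λ → Bool) × (↥V → Bool),
        p a.1 * g a.1 * (p (blockUpdate a.1 a.2) * F (blockUpdate a.1 a.2)) / Z a.1 := by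
        rw [Fintype.sum_prod_type]
        refine Finset.sum_congr rfl fun η _ => ?_
        change p η * (g η * _) = _
        rw [hgibbs]
        dsimp only
        rw [← Finset.sum_div, ← Finset.mul_sum]
        ring
    _ = ∑ a : (↥Λ → Bool) × (↥V → Bool),
        p (blockUpdate a.1 a.2) * (p a.1 * g a.1 * F a.1 / Z a.1) := by
        rw [← Equiv.sum_comp (Function.Involutive.toPerm _ hinv)]
        refine Finset.sum_congr rfl fun a _ => ?_
        have h1 : blockUpdate (blockUpdate a.1 a.2) (fun x : ↥V => a.1 ⟨x, hV x.2⟩) = a.1 :=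
          congrArg Prod.fst (hinv a)
        have h2 : g (blockUpdate a.1 a.2) = g a.1 := hg _ _ fun x hx => hoff _ _ x hx
        have h3 : Z (blockUpdate a.1 a.2) = Z a.1 := by simp only [hZ, hupd]
        simp only [Function.Involutive.coe_toPerm, h1, h2, h3]
        ring
    _ = _ := by
        rw [Fintype.sum_prod_type]
        refine Finset.sum_congr rfl fun η _ => ?_
        have := (hZpos η).ne'
        simp only
        rw [← Finset.sum_mul]
        change Z η * _ = p η * _
        field_simp

/-! ### Blocks of cubes -/

/-- The box of `L ^ d` cube labels with lowest corner `j`. -/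
def labelBox {d : ℕ} (L : ℕ) (j : ZLat d) : Finset (ZLat d) :=
  Fintype.piFinset fun k => Finset.Ico (j k) (j k + L)

lemma mem_labelBox {d : ℕ} {L : ℕ} {i j : ZLat d} :
    i ∈ labelBox L j ↔ ∀ k, j k ≤ i k ∧ i k < j k + L := by
  simp [labelBox, Fintype.mem_piFinset]

lemma card_labelBox {d : ℕ} (L : ℕ) (j : ZLat d) : (labelBox L j).card = L ^ d := by
  simp [labelBox, Fintype.card_piFinset]

/-- The labels `j` with `-s ≤ i - j < L + s` coordinatewise. -/
def cornerBox {d : ℕ} (L s : ℕ) (i : ZLat d) : Finset (ZLat d) :=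
  Fintype.piFinset fun k => Finset.Ioc (i k - L - s) (i k + s)

lemma mem_cornerBox {d : ℕ} {L s : ℕ} {i j : ZLat d} :
    j ∈ cornerBox L s i ↔ ∀ k, i k - L - s < j k ∧ j k ≤ i k + s := by
  simp [cornerBox, Fintype.mem_piFinset]

lemma mem_cornerBox_zero {d : ℕ} {L : ℕ} {i j : ZLat d} :
    j ∈ cornerBox L 0 i ↔ i ∈ labelBox L j := by
  rw [mem_cornerBox, mem_labelBox]
  refine forall_congr' fun k => ?_
  push_cast
  constructor <;> rintro ⟨h1, h2⟩ <;> constructor <;> omega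

lemma card_cornerBox {d : ℕ} (L s : ℕ) (i : ZLat d) :
    (cornerBox L s i).card = (L + 2 * s) ^ d := by
  have : ∀ k, (i k + s - (i k - L - s)).toNat = L + 2 * s := fun k => by omega
  simp [cornerBox, Fintype.card_piFinset, this]

lemma card_cornerBox_sdiff {d : ℕ} (L s : ℕ) (i : ZLat d) :
    ((cornerBox L s i \ cornerBox L 0 i).card : ℝ) = ((L + 2 * s : ℕ) : ℝ) ^ d - (L : ℝ) ^ d := by
  have hsub : cornerBox L 0 i ⊆ cornerBox L s i := fun j hj => by
    rw [mem_cornerBox] at hj ⊢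
    intro k
    have := hj k
    push_cast at this
    omega
  rw [Finset.cast_card_sdiff hsub, card_cornerBox, card_cornerBox]
  simp

lemma supD_le_of_mem_block {d : ℕ} {ℓ L : ℕ} (hℓ : 0 < ℓ) {I : Finset (ZLat d)} {j x y : ZLat d}
    (hx : x ∈ cubesRegion ℓ (I ∩ labelBox L j)) (hy : y ∈ cubesRegion ℓ (I ∩ labelBox L j)) :
    supD x y ≤ ℓ * L := by
  rw [mem_cubesRegion_iff hℓ, Finset.mem_inter, mem_labelBox] at hx hy
  have hℓ' : (0 : ℤ) < ℓ := by exact_mod_cast hℓ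
  rw [supD_le_iff]
  intro k
  have h1 := hx.2 k
  have h2 := hy.2 k
  have e1 := Int.mul_ediv_add_emod (x k) ℓ
  have e2 := Int.mul_ediv_add_emod (y k) ℓ
  have r1 := Int.emod_nonneg (x k) hℓ'.ne'
  have r2 := Int.emod_nonneg (y k) hℓ'.ne'
  have s1 := Int.emod_lt_of_pos (x k) hℓ'
  have s2 := Int.emod_lt_of_pos (y k) hℓ'
  have a1 : (ℓ : ℤ) * (x k / ℓ - y k / ℓ) ≤ ℓ * (L - 1) :=
    mul_le_mul_of_nonneg_left (by omega) hℓ'.le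
  have a2 : (ℓ : ℤ) * (y k / ℓ - x k / ℓ) ≤ ℓ * (L - 1) :=
    mul_le_mul_of_nonneg_left (by omega) hℓ'.le
  have : |x k - y k| ≤ (ℓ : ℤ) * L := abs_le.2 ⟨by linarith, by linarith⟩
  rw [Int.abs_eq_natAbs] at this
  exact_mod_cast this

lemma ediv_le_ediv_add {ℓ : ℤ} (hℓ : 0 < ℓ) {a c : ℤ} {r : ℕ} (h : a ≤ c + r) :
    a / ℓ ≤ c / ℓ + r := by
  have h1 : a ≤ c + r * ℓ := by nlinarith [Int.natCast_nonneg r]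
  have h2 := Int.ediv_le_ediv hℓ h1
  rwa [Int.add_mul_ediv_right _ _ hℓ.ne'] at h2

/-! ### Strong mixing of the perturbed potential -/

/-- The effect of one spin on a block average: none from inside the block, a bounded one from
its boundary layer, and no amplification from elsewhere. -/
lemma SM.abs_gibbsExp_block_sub_le {d : ℕ} {G : LatticeGas d} {ℓ0 : ℕ} {b B K : ℝ}
    (hb : 0 < b) (hB : 0 < B) (hSM : SM (gasPotH G) ℓ0 b B) (hK : ∀ X σ, |G.U X σ| ≤ K)
    {k : ℕ} (hk : ((2 * G.r + 1 : ℕ) : ℝ) ^ d * Real.exp (-b * k) ≤ 1)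
    {zf : ZLat d → ℝ} {s : ℝ} (hs : ∀ x, |Real.log (zf x) - Real.log G.z| ≤ s)
    {I Λ : Finset (ZLat d)} {nV : ℝ} (hnV : ((cubesRegion ℓ0 I).card : ℝ) ≤ nV)
    {y : ZLat d} {ξ ξ' : GConf d} (hξ : ∀ x, x ≠ y → ξ x = ξ' x)
    {w : ZLat d → ℝ} (hw0 : ∀ x, 0 ≤ w x)
    (hw : ∀ x ∈ cubesRegion ℓ0 I, ∀ x₀ ∈ cubesRegion ℓ0 I, supD x₀ y ≤ G.r → w x ≤ 2 * w y)
    {M : ℝ} (hM : M = 4 * ((2 * (k + G.r) + 1 : ℕ) : ℝ) ^ d +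
      (4 * (Real.exp (2 * (nV * s)) - 1) +
        2 * (B * Real.exp (2 * (2 ^ ((2 * G.r + 1) ^ d) * (2 * K))) *
          ((2 * G.r + 1 : ℕ) : ℝ) ^ d * Real.exp (-b * k))) * nV)
    {F : GConf d → ℝ}
    (hF : ∀ σ σ' : GConf d, |F σ - F σ'| ≤ ∑ x ∈ Λ, if σ x ≠ σ' x then w x else 0) :
    |gibbsExp (gasPot G zf) (cubesRegion ℓ0 I) ξ F -
        gibbsExp (gasPot G zf) (cubesRegion ℓ0 I) ξ' F| ≤
      w y - (if y ∈ cubesRegion ℓ0 I then w y else 0) +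
        if ¬ y ∈ cubesRegion ℓ0 I ∧ ∃ x ∈ cubesRegion ℓ0 I, supD x y ≤ G.r
          then M * w y else 0 := by
  set V := cubesRegion ℓ0 I
  by_cases hyV : y ∈ V
  · have : ∀ σ : ↥V → Bool, override V σ ξ = override V σ ξ' := by
      intro σ
      funext x
      by_cases hx : x ∈ V
      · simp [override, hx]
      · simp only [override, hx, dif_neg, not_false_iff]
        exact hξ x fun e => hx (e ▸ hyV)
    simp [gibbsExp_eq_wAvg, this, hyV]
  · by_cases hyb : ∃ x ∈ V, supD x y ≤ G.r
    · have hw' : ∀ x ∈ V, w x ≤ 2 * w y := by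
        obtain ⟨x₀, hx₀, hx₀y⟩ := hyb
        exact fun x hx => hw x hx x₀ hx₀ hx₀y
      have h := hSM.abs_gibbsExp_perturbed_sub_le hb hB hK hk hs hnV hyV hξ (hw0 y) hw' hF
      rw [← hM] at h
      rw [if_neg hyV, if_pos ⟨hyV, hyb⟩, sub_zero]
      exact h
    · have hfar : ∀ x ∈ V, G.r < supD x y := fun x hx => by
        by_contra h
        exact hyb ⟨x, hx, not_lt.1 h⟩
      have hoff : ∀ (σ : ↥V → Bool) (x : ZLat d), x ≠ y → override V σ ξ x = override V σ ξ' x :=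
        fun σ x hx => by
          unfold override
          rw [hξ x hx]
      have hwt : ∀ σ : ↥V → Bool, hamil (gasPot G zf) V (override V σ ξ) =
          hamil (gasPot G zf) V (override V σ ξ') := fun σ =>
        (hasRange_gasPot G zf).hamil_congr_of_far hfar fun x hx => hoff σ x hx
      rw [if_neg hyV, if_neg fun h => hyb h.2, sub_zero, add_zero]
      simp only [gibbsExp_eq_wAvg, hwt]
      refine abs_wAvg_sub_le (fun _ => Real.exp_pos _) fun σ => (hF _ _).trans ?_
      have hle : ∀ x ∈ Λ, (if override V σ ξ x ≠ override V σ ξ' x then w x else 0) ≤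
          if x = y then w y else 0 := fun x _ => by
        by_cases hxy : x = y
        · rw [hxy, if_pos rfl]
          split_ifs
          · exact le_rfl
          · exact hw0 y
        · rw [if_neg (not_not.2 (hoff σ x hxy)), if_neg hxy]
      refine (Finset.sum_le_sum hle).trans ?_
      rw [Finset.sum_ite_eq']
      split_ifs
      · exact le_rfl
      · exact hw0 y

/-- Block contraction implies exponential decay of correlations, at a rate which does not depend
on the region. -/
theorem SM.abs_cov_perturbed_le {d : ℕ} {G : LatticeGas d} {ℓ0 : ℕ} (hℓ0 : 0 < ℓ0) {b B K : ℝ}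
    (hb : 0 < b) (hB : 0 < B) (hSM : SM (gasPotH G) ℓ0 b B) (hK : ∀ X σ, |G.U X σ| ≤ K)
    {k : ℕ} (hk : ((2 * G.r + 1 : ℕ) : ℝ) ^ d * Real.exp (-b * k) ≤ 1)
    {L : ℕ} (hL : 0 < L) {M s : ℝ}
    (hM : M = 4 * ((2 * (k + G.r) + 1 : ℕ) : ℝ) ^ d +
      (4 * (Real.exp (2 * ((L : ℝ) ^ d * (ℓ0 : ℝ) ^ d * s)) - 1) +
        2 * (B * Real.exp (2 * (2 ^ ((2 * G.r + 1) ^ d) * (2 * K))) *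
          ((2 * G.r + 1 : ℕ) : ℝ) ^ d * Real.exp (-b * k))) * ((L : ℝ) ^ d * (ℓ0 : ℝ) ^ d))
    (hML : M * (((L + 2 * G.r : ℕ) : ℝ) ^ d - (L : ℝ) ^ d) ≤ (L : ℝ) ^ d / 2)
    {δ : ℝ} (hδ0 : 0 < δ) (hδ : Real.exp (δ * (ℓ0 * L + G.r)) ≤ 2)
    {zf : ZLat d → ℝ} (hs : ∀ x, |Real.log (zf x) - Real.log G.z| ≤ s)
    (I : Finset (ZLat d)) {f g : GConf d → ℝ} {Sf Sg : Finset (ZLat d)}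
    (hf : LocalOn f Sf) (hg : LocalOn g Sg) (hSf : Sf ⊆ cubesRegion ℓ0 I) (τ : GConf d) :
    |gibbsExp (gasPot G zf) (cubesRegion ℓ0 I) τ (fun σ => f σ * g σ) -
        gibbsExp (gasPot G zf) (cubesRegion ℓ0 I) τ f *
          gibbsExp (gasPot G zf) (cubesRegion ℓ0 I) τ g| ≤
      16 * ((2 * (ℓ0 * L) + 1 : ℕ) : ℝ) ^ d * supNorm f * supNorm g * Sg.card *
        Real.exp (-δ * fDist Sf Sg) := by
  set Φ := gasPot G zf
  have hΦ : HasRange Φ G.r := hasRange_gasPot G zf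
  set Λ := cubesRegion ℓ0 I with hΛ
  set V : ZLat d → Finset (ZLat d) := fun j => cubesRegion ℓ0 (I ∩ labelBox L j) with hV
  have hVΛ : ∀ j, V j ⊆ Λ := fun j => cubesRegion_mono ℓ0 Finset.inter_subset_left
  have hVcard : ∀ j, ((V j).card : ℝ) ≤ (L : ℝ) ^ d * (ℓ0 : ℝ) ^ d := fun j => by
    have h1 : (I ∩ labelBox L j).card ≤ L ^ d :=
      (Finset.card_le_card Finset.inter_subset_right).trans (card_labelBox L j).le
    have h2 := (card_cubesRegion_le ℓ0 (I ∩ labelBox L j)).trans (Nat.mul_le_mul_right _ h1)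
    exact_mod_cast h2
  set w : ZLat d → ℝ := fun x => Real.exp (δ * fDist {x} Sg) with hw
  have hw0 : ∀ x, 0 < w x := fun x => Real.exp_pos _
  have hw2 : ∀ x y, supD x y ≤ ℓ0 * L + G.r → w x ≤ 2 * w y := by
    intro x y hxy
    have h1 := fDist_singleton_le_add Sg x y
    have h2 : (supD x y : ℝ) ≤ ℓ0 * L + G.r := by exact_mod_cast hxy
    calc w x ≤ Real.exp (δ * (ℓ0 * L + G.r) + δ * fDist {y} Sg) :=
          Real.exp_le_exp.2 (by nlinarith)
      _ = Real.exp (δ * (ℓ0 * L + G.r)) * w y := Real.exp_add _ _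
      _ ≤ 2 * w y := mul_le_mul_of_nonneg_right hδ (hw0 y).le
  set p : (↥Λ → Bool) → ℝ := fun η => Real.exp (hamil Φ Λ (override Λ η τ)) with hp
  have hppos : ∀ η, 0 < p η := fun η => Real.exp_pos _
  set fΛ : (↥Λ → Bool) → ℝ := fun η => f (override Λ η τ) with hfΛ
  set gΛ : (↥Λ → Bool) → ℝ := fun η => g (override Λ η τ) with hgΛ
  set gm := wAvg p gΛ with hgm
  set q : (↥Λ → Bool) → ℝ := fun η => p η * (gΛ η - gm) / ∑ η, p η with hq
  have hqF : ∀ F : (↥Λ → Bool) → ℝ, ∑ η, q η * F η = wAvg p fun η => (gΛ η - gm) * F η := by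
    intro F
    unfold wAvg
    rw [Finset.sum_div]
    exact Finset.sum_congr rfl fun η _ => by simp only [hq]; ring
  have hgbd : ∀ η, |gΛ η - gm| ≤ 2 * supNorm g := fun η => by
    have h1 := hg.abs_le_supNorm (override Λ η τ)
    have h2 : |gm| ≤ supNorm g := abs_wAvg_le hppos fun η => hg.abs_le_supNorm _
    refine (abs_sub _ _).trans ?_
    linarith
  have hq0 : ∑ η, q η = 0 := by
    have h := hqF fun _ => 1
    simp only [mul_one, sub_eq_add_neg, wAvg_add_const hppos] at h
    rw [h, ← hgm]
    ring
  have hqosc : ∀ (F : (↥Λ → Bool) → ℝ) (u : ℝ), (∀ η η', |F η - F η'| ≤ u) →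
      |∑ η, q η * F η| ≤ 2 * supNorm g * u := by
    intro F u hu
    set η₀ : ↥Λ → Bool := fun _ => false
    have h1 : ∑ η, q η * F η = ∑ η, q η * (F η - F η₀) := by
      simp only [mul_sub, Finset.sum_sub_distrib, ← Finset.sum_mul, hq0, zero_mul, sub_zero]
    rw [h1, hqF]
    refine abs_wAvg_le hppos fun η => ?_
    rw [abs_mul]
    exact mul_le_mul (hgbd η) (hu _ _) (abs_nonneg _) ((abs_nonneg _).trans (hgbd η))
  set J : Finset (ZLat d) := (I.biUnion fun i => cornerBox L 0 i).filter fun j =>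
    Disjoint (V j) Sg with hJ
  set E : ZLat d → ((↥Λ → Bool) → ℝ) → (↥Λ → Bool) → ℝ := fun j F η =>
    gibbsExp Φ (V j) (override Λ η τ) fun σ => F fun x => σ x with hE
  have hEinv : ∀ j ∈ J, ∀ F : (↥Λ → Bool) → ℝ, ∑ η, q η * E j F η = ∑ η, q η * F η := by
    intro j hj F
    have hdisj : Disjoint (V j) Sg := (Finset.mem_filter.1 hj).2
    rw [hqF, hqF]
    unfold wAvg
    congr 1
    refine sum_mul_gibbsExp_eq hΦ (hVΛ j) τ (g := fun η => gΛ η - gm) (fun η η' h => ?_) F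
    have : gΛ η = gΛ η' := by
      refine hg _ _ fun x hx => ?_
      have hxV : x ∉ V j := fun h' => Finset.disjoint_left.1 hdisj h' hx
      by_cases hxΛ : x ∈ Λ
      · simp only [override, hxΛ, dif_pos]
        exact h ⟨x, hxΛ⟩ hxV
      · simp [override, hxΛ]
    rw [this]
  obtain ⟨inV, hinV⟩ : ∃ P : ZLat d → ↥Λ → Prop, ∀ j y, P j y ↔ y.1 ∈ V j :=
    ⟨_, fun _ _ => Iff.rfl⟩
  obtain ⟨bd, hbd⟩ : ∃ P : ZLat d → ↥Λ → Prop, ∀ j y, P j y ↔ ∃ x ∈ V j, supD x y ≤ G.r :=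
    ⟨_, fun _ _ => Iff.rfl⟩
  have hosc : ∀ j ∈ J, ∀ F : (↥Λ → Bool) → ℝ, HamLip (fun x : ↥Λ => w x) F →
      ∀ y, ∀ η η' : ↥Λ → Bool,
      (∀ x, x ≠ y → η x = η' x) → |E j F η - E j F η'| ≤
        w y - (if inV j y then w y else 0) + if ¬ inV j y ∧ bd j y then M * w y else 0 := by
    intro j _ F hF y η η' hη
    have hξ : ∀ x, x ≠ y.1 → override Λ η τ x = override Λ η' τ x := by
      intro x hx
      by_cases hxΛ : x ∈ Λ
      · simp only [override, hxΛ, dif_pos]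
        exact hη ⟨x, hxΛ⟩ fun e => hx (congrArg Subtype.val e)
      · simp [override, hxΛ]
    have hF' : ∀ σ σ' : GConf d, |F (fun x => σ x) - F (fun x => σ' x)| ≤
        ∑ x ∈ Λ, if σ x ≠ σ' x then w x else 0 := fun σ σ' => by
      refine (hF _ _).trans (le_of_eq ?_)
      rw [← Finset.sum_coe_sort Λ]
    have h := hSM.abs_gibbsExp_block_sub_le hb hB hK hk hs (hVcard j) hξ (fun x => (hw0 x).le)
      (fun x hx x₀ hx₀ hx₀y => hw2 x y ((supD_triangle x x₀ y).trans
        (add_le_add (supD_le_of_mem_block hℓ0 hx hx₀) hx₀y))) hM hF'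
    simpa only [hinV, hbd] using h
  obtain ⟨near, hnear⟩ : ∃ P : ↥Λ → Prop, ∀ y, P y ↔ ∃ v ∈ Sg, supD v y ≤ ℓ0 * L :=
    ⟨_, fun _ => Iff.rfl⟩
  have hcountV : ∀ y, ¬ near y → (L : ℝ) ^ d ≤ ((J.filter fun j => inV j y).card : ℝ) := by
    intro y hy
    rw [← Nat.cast_pow]
    have hyΛ := (mem_cubesRegion_iff hℓ0).1 y.2
    have : (L + 2 * 0) ^ d = L ^ d := by simp
    rw [← this, ← card_cornerBox L 0 fun k => y.1 k / (ℓ0 : ℤ)]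
    refine Nat.cast_le.2 (Finset.card_le_card fun j hj => ?_)
    have hyV : y.1 ∈ V j := (mem_cubesRegion_iff hℓ0).2
      (Finset.mem_inter.2 ⟨hyΛ, mem_cornerBox_zero.1 hj⟩)
    refine Finset.mem_filter.2 ⟨Finset.mem_filter.2 ⟨Finset.mem_biUnion.2 ⟨_, hyΛ, hj⟩, ?_⟩,
      (hinV j y).2 hyV⟩
    rw [Finset.disjoint_left]
    intro v hv hvg
    exact hy ((hnear y).2 ⟨v, hvg, supD_le_of_mem_block hℓ0 hv hyV⟩)
  have hM0 : 0 ≤ M := by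
    have hs0 : 0 ≤ s := (abs_nonneg _).trans (hs 0)
    have : 0 ≤ Real.exp (2 * ((L : ℝ) ^ d * (ℓ0 : ℝ) ^ d * s)) - 1 :=
      sub_nonneg.2 (Real.one_le_exp (by positivity))
    rw [hM]
    positivity
  have hcountbd : ∀ y, M * ((J.filter fun j => ¬ inV j y ∧ bd j y).card : ℝ) ≤
      (L : ℝ) ^ d / 2 := by
    intro y
    refine le_trans (mul_le_mul_of_nonneg_left ?_ hM0) hML
    rw [← card_cornerBox_sdiff L G.r fun k => y.1 k / (ℓ0 : ℤ)]
    refine Nat.cast_le.2 (Finset.card_le_card fun j hj => ?_)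
    obtain ⟨-, hyV, hyb⟩ := Finset.mem_filter.1 hj
    rw [hinV] at hyV
    obtain ⟨x, hx, hxy⟩ := (hbd j y).1 hyb
    have hyΛ := (mem_cubesRegion_iff hℓ0).1 y.2
    refine Finset.mem_sdiff.2 ⟨mem_cornerBox.2 fun i => ?_, fun h => hyV ?_⟩
    · have hx' := mem_labelBox.1 (Finset.mem_inter.1 ((mem_cubesRegion_iff hℓ0).1 hx)).2 i
      have hxy' := supD_le_iff.1 hxy i
      have hℓ' : (0 : ℤ) < ℓ0 := by exact_mod_cast hℓ0
      have h1 := ediv_le_ediv_add (r := G.r) hℓ' (a := x i) (c := y.1 i) (by omega)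
      have h2 := ediv_le_ediv_add (r := G.r) hℓ' (a := y.1 i) (c := x i) (by omega)
      constructor <;> omega
    · exact (mem_cubesRegion_iff hℓ0).2 (Finset.mem_inter.2 ⟨hyΛ, mem_cornerBox_zero.1 h⟩)
  have hmain : ∀ F : (↥Λ → Bool) → ℝ, HamLip (fun x : ↥Λ => w x) F → |∑ η, q η * F η| ≤
      2 * (2 * supNorm g) * ∑ x : ↥Λ, if near x then w x else 0 := fun F hF =>
    abs_functional_le_of_contraction (S := ↥Λ) (w := fun x => w x) (fun x => (hw0 x).le) hqosc J
      inV bd E hEinv (by positivity) hosc near hcountV hcountbd hF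
  have hR : (∑ x : ↥Λ, if near x then w x else 0) ≤
      Sg.card * (((2 * (ℓ0 * L) + 1 : ℕ) : ℝ) ^ d * 2) := by
    calc (∑ x : ↥Λ, if near x then w x else 0)
        ≤ ∑ x : ↥Λ, ∑ v ∈ Sg, if x.1 ∈ latBall v (ℓ0 * L) then 2 else 0 := by
          refine Finset.sum_le_sum fun x _ => ?_
          have hnn : ∀ v ∈ Sg, (0 : ℝ) ≤ if x.1 ∈ latBall v (ℓ0 * L) then 2 else 0 :=
            fun v _ => by split_ifs <;> norm_num
          split_ifs with hx
          · obtain ⟨v, hv, hvx⟩ := (hnear x).1 hx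
            refine le_trans ?_ (Finset.single_le_sum hnn hv)
            rw [if_pos (mem_latBall.2 hvx)]
            have h1 := fDist_le (Finset.mem_singleton_self x.1) hv
            have h2 : (supD x.1 v : ℝ) ≤ ℓ0 * L := by
              rw [supD_comm]; exact_mod_cast hvx
            refine (Real.exp_le_exp.2 ?_).trans hδ
            have : (0 : ℝ) ≤ G.r := Nat.cast_nonneg _
            exact mul_le_mul_of_nonneg_left (by linarith) hδ0.le
          · exact Finset.sum_nonneg hnn
      _ = ∑ v ∈ Sg, ∑ x ∈ Λ, if x ∈ latBall v (ℓ0 * L) then 2 else 0 := by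
          rw [Finset.sum_comm]
          exact Finset.sum_congr rfl fun v _ =>
            Finset.sum_coe_sort Λ fun x => if x ∈ latBall v (ℓ0 * L) then (2 : ℝ) else 0
      _ ≤ ∑ v ∈ Sg, (((2 * (ℓ0 * L) + 1 : ℕ) : ℝ) ^ d * 2) := by
          refine Finset.sum_le_sum fun v _ => ?_
          have := sum_indicator_le Λ (latBall v (ℓ0 * L)) (zero_le_two (α := ℝ))
          rwa [card_latBall, Nat.cast_pow] at this
      _ = _ := by rw [Finset.sum_const, nsmul_eq_mul]
  have hcov : gibbsExp Φ Λ τ (fun σ => f σ * g σ) - gibbsExp Φ Λ τ f * gibbsExp Φ Λ τ g =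
      ∑ η, q η * fΛ η := by
    rw [hqF]
    have h1 : gibbsExp Φ Λ τ g = gm := rfl
    rw [h1]
    unfold gibbsExp partFun wAvg
    rw [div_mul_eq_mul_div, ← sub_div, Finset.sum_mul, ← Finset.sum_sub_distrib]
    congr 1
    exact Finset.sum_congr rfl fun η _ => by simp only [hp, hfΛ, hgΛ]; ring
  set Df := fDist Sf Sg with hDf
  have hf0 := supNorm_nonneg f
  have hg0 := supNorm_nonneg g
  have hLipf : ∀ t : ℝ, 0 < t → t * (2 * supNorm f) ≤ 1 →
      HamLip (fun x : ↥Λ => w x) fun η => t * Real.exp (δ * Df) * fΛ η := by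
    intro t ht htf η η'
    have hnn : ∀ x ∈ (Finset.univ : Finset ↥Λ), 0 ≤ if η x ≠ η' x then w x else 0 :=
      fun x _ => by
        split_ifs
        · exact (hw0 x).le
        · exact le_rfl
    by_cases hx : ∃ x : ↥Λ, x.1 ∈ Sf ∧ η x ≠ η' x
    · obtain ⟨x, hxf, hxne⟩ := hx
      refine le_trans ?_ (Finset.single_le_sum hnn (Finset.mem_univ x))
      rw [if_pos hxne, ← mul_sub, abs_mul, abs_of_pos (by positivity)]
      have h1 : |fΛ η - fΛ η'| ≤ 2 * supNorm f := by
        refine (abs_sub _ _).trans ?_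
        have h1 := hf.abs_le_supNorm (override Λ η τ)
        have h2 := hf.abs_le_supNorm (override Λ η' τ)
        simp only [hfΛ]
        linarith
      have h2 : Real.exp (δ * Df) ≤ w x := by
        refine Real.exp_le_exp.2 (mul_le_mul_of_nonneg_left ?_ hδ0.le)
        rcases Sg.eq_empty_or_nonempty with he | hne
        · simp [hDf, he, fDist]
        · exact le_fDist (Finset.singleton_nonempty _) hne fun u hu v hv =>
            fDist_le (by rwa [Finset.mem_singleton.1 hu]) hv
      calc t * Real.exp (δ * Df) * |fΛ η - fΛ η'|
          ≤ t * Real.exp (δ * Df) * (2 * supNorm f) :=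
            mul_le_mul_of_nonneg_left h1 (by positivity)
        _ = (t * (2 * supNorm f)) * Real.exp (δ * Df) := by ring
        _ ≤ 1 * Real.exp (δ * Df) := mul_le_mul_of_nonneg_right htf (Real.exp_pos _).le
        _ ≤ w x := by rwa [one_mul]
    · push Not at hx
      have : fΛ η = fΛ η' := hf _ _ fun x hxf => by
        have hxΛ := hSf hxf
        simp only [override, hxΛ, dif_pos]
        exact hx ⟨x, hxΛ⟩ hxf
      dsimp only
      rw [this, sub_self, abs_zero]
      exact Finset.sum_nonneg hnn
  set C := 2 * (2 * supNorm g) * (Sg.card * (((2 * (ℓ0 * L) + 1 : ℕ) : ℝ) ^ d * 2)) with hC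
  have hfin : ∀ t : ℝ, 0 < t → t * (2 * supNorm f) ≤ 1 →
      t * Real.exp (δ * Df) * |∑ η, q η * fΛ η| ≤ C := by
    intro t ht htf
    have h := (hmain _ (hLipf t ht htf)).trans (mul_le_mul_of_nonneg_left hR (by positivity))
    have e : ∑ η, q η * (t * Real.exp (δ * Df) * fΛ η) =
        t * Real.exp (δ * Df) * ∑ η, q η * fΛ η := by
      rw [Finset.mul_sum]
      exact Finset.sum_congr rfl fun η _ => by ring
    rwa [e, abs_mul, abs_of_pos (by positivity)] at h
  rw [hcov]
  have hee : Real.exp (-δ * Df) * Real.exp (δ * Df) = 1 := by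
    rw [← Real.exp_add]; simp
  rcases hf0.eq_or_lt with hf00 | hfpos
  · have : ∑ η, q η * fΛ η = 0 := by
      refine Finset.sum_eq_zero fun η _ => ?_
      have := hf.abs_le_supNorm (override Λ η τ)
      rw [← hf00] at this
      simp only [hfΛ]
      rw [abs_nonpos_iff.1 this, mul_zero]
    rw [this, ← hf00]
    simp
  · have h := hfin (2 * supNorm f)⁻¹ (by positivity) (by rw [inv_mul_cancel₀ (by positivity)])
    have h' := mul_le_mul_of_nonneg_left h
      (by positivity : 0 ≤ 2 * supNorm f * Real.exp (-δ * Df))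
    calc |∑ η, q η * fΛ η| = 2 * supNorm f * Real.exp (-δ * Df) *
          ((2 * supNorm f)⁻¹ * Real.exp (δ * Df) * |∑ η, q η * fΛ η|) := by
          have : 2 * supNorm f * Real.exp (-δ * Df) *
              ((2 * supNorm f)⁻¹ * Real.exp (δ * Df) * |∑ η, q η * fΛ η|) =
              (2 * supNorm f * (2 * supNorm f)⁻¹) *
                (Real.exp (-δ * Df) * Real.exp (δ * Df)) * |∑ η, q η * fΛ η| := by ring
          rw [this, hee, mul_inv_cancel₀ (by positivity)]
          ring
      _ ≤ _ := h'
      _ = _ := by rw [hC]; ring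

/-! ### Choice of the constants -/

lemma one_add_pow_sub_one_le {x : ℝ} (hx0 : 0 ≤ x) (hx1 : x ≤ 1) (d : ℕ) :
    (1 + x) ^ d - 1 ≤ (2 ^ d - 1) * x := by
  induction d with
  | zero => simp
  | succ n ih =>
    have h1 : (1 : ℝ) ≤ 2 ^ n := one_le_pow₀ (by norm_num)
    have h2 := mul_le_mul_of_nonneg_right ih (by linarith : 0 ≤ 1 + x)
    have h3 : ((2 : ℝ) ^ n - 1) * x * (1 + x) ≤ (2 ^ n - 1) * x * 2 :=
      mul_le_mul_of_nonneg_left (by linarith) (mul_nonneg (by linarith) hx0)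
    rw [pow_succ, pow_succ]
    linarith

/-- The number of blocks near a site grows slower than the volume of a block. -/
lemma exists_block_size (d r : ℕ) {b c : ℝ} (hb : 0 < b) (hc : 0 ≤ c) :
    ∃ k L : ℕ, 0 < L ∧ ((2 * r + 1 : ℕ) : ℝ) ^ d * Real.exp (-b * k) ≤ 1 ∧
      (4 * ((2 * (k + r) + 1 : ℕ) : ℝ) ^ d + 1 + c * Real.exp (-b * k) * (L : ℝ) ^ d) *
        (((L + 2 * r : ℕ) : ℝ) ^ d - (L : ℝ) ^ d) ≤ (L : ℝ) ^ d / 2 := by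
  set A : ℝ := 4 * 3 ^ d + 1 + c with hA
  have hexp : ∀ n : ℕ, Filter.Tendsto (fun k : ℕ => (k : ℝ) ^ n * Real.exp (-b * k))
      Filter.atTop (nhds 0) := fun n => by
    have h := (Real.tendsto_pow_mul_exp_neg_atTop_nhds_zero n).comp
      (tendsto_natCast_atTop_atTop (R := ℝ) |>.const_mul_atTop hb)
    have h' := h.const_mul ((b ^ n)⁻¹)
    rw [mul_zero] at h'
    refine h'.congr fun k => ?_
    simp only [Function.comp_apply, mul_pow, neg_mul]
    field_simp
  have e1 : ∀ᶠ k : ℕ in Filter.atTop, ((2 * r + 1 : ℕ) : ℝ) ^ d * Real.exp (-b * k) ≤ 1 := by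
    have h := (hexp 0).const_mul (((2 * r + 1 : ℕ) : ℝ) ^ d)
    simp only [pow_zero, one_mul, mul_zero] at h
    exact h.eventually_le_const one_pos
  have e2 : ∀ᶠ k : ℕ in Filter.atTop, (k : ℝ) ^ ((d + 1) * d) * Real.exp (-b * k) ≤ 1 :=
    (hexp _).eventually_le_const one_pos
  have e3 : ∀ᶠ k : ℕ in Filter.atTop, A * (2 ^ d * (2 * r)) * 2 ≤ (k : ℝ) :=
    tendsto_natCast_atTop_atTop.eventually_ge_atTop _
  obtain ⟨k, h1, h2, h3, hk⟩ := (e1.and (e2.and (e3.and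
    (Filter.eventually_ge_atTop (2 * r + 1))))).exists
  have hk1 : (1 : ℝ) ≤ k := by exact_mod_cast (by omega : 1 ≤ k)
  have hk0 : (0 : ℝ) < k := by linarith
  have hkd : (1 : ℝ) ≤ (k : ℝ) ^ d := one_le_pow₀ hk1
  refine ⟨k, k ^ (d + 1), Nat.pow_pos (by omega), h1, ?_⟩
  push_cast
  set L : ℝ := (k : ℝ) ^ (d + 1) with hL
  have hL0 : 0 < L := by positivity
  have hkL : (k : ℝ) ≤ L := by
    rw [hL, pow_succ]
    nlinarith
  have hM : 4 * (2 * ((k : ℝ) + r) + 1) ^ d + 1 + c * Real.exp (-b * k) * L ^ d ≤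
      A * (k : ℝ) ^ d := by
    have hk3 : 2 * ((k : ℝ) + r) + 1 ≤ 3 * k := by
      have : (2 * (r : ℝ) + 1) ≤ k := by exact_mod_cast hk
      linarith
    have g1 : (2 * ((k : ℝ) + r) + 1) ^ d ≤ 3 ^ d * (k : ℝ) ^ d := by
      rw [← mul_pow]
      exact pow_le_pow_left₀ (by positivity) hk3 d
    have g2 : c * Real.exp (-b * k) * L ^ d ≤ c := by
      rw [hL, ← pow_mul]
      calc c * Real.exp (-b * k) * (k : ℝ) ^ ((d + 1) * d)
          = c * ((k : ℝ) ^ ((d + 1) * d) * Real.exp (-b * k)) := by ring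
        _ ≤ c * 1 := mul_le_mul_of_nonneg_left h2 hc
        _ = c := mul_one c
    have g3 : c ≤ c * (k : ℝ) ^ d := le_mul_of_one_le_right hc hkd
    rw [hA]
    nlinarith
  have hβ : (L + 2 * r) ^ d - L ^ d ≤ L ^ d * (2 ^ d * (2 * r / L)) := by
    have hx1 : 2 * (r : ℝ) / L ≤ 1 := by
      rw [div_le_one hL0]
      have : (2 * (r : ℝ) + 1) ≤ k := by exact_mod_cast hk
      linarith
    have e : (L + 2 * r) ^ d - L ^ d = L ^ d * ((1 + 2 * r / L) ^ d - 1) := by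
      rw [mul_sub, ← mul_pow, mul_add, mul_div_cancel₀ _ hL0.ne', mul_one, mul_one]
    rw [e]
    refine mul_le_mul_of_nonneg_left
      ((one_add_pow_sub_one_le (by positivity) hx1 d).trans ?_) (by positivity)
    exact mul_le_mul_of_nonneg_right (by linarith) (by positivity)
  have hβ0 : 0 ≤ (L + 2 * r) ^ d - L ^ d :=
    sub_nonneg.2 (pow_le_pow_left₀ hL0.le (by linarith [Nat.cast_nonneg (α := ℝ) r]) d)
  calc _ ≤ A * (k : ℝ) ^ d * (L ^ d * (2 ^ d * (2 * r / L))) :=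
        mul_le_mul hM hβ hβ0 (by positivity)
    _ = A * (2 ^ d * (2 * r)) / k * L ^ d := by
        rw [hL, pow_succ (k : ℝ) d]
        field_simp
    _ ≤ 1 / 2 * L ^ d := by
        refine mul_le_mul_of_nonneg_right ?_ (by positivity)
        rw [div_le_iff₀ hk0]
        linarith
    _ = L ^ d / 2 := by ring

lemma exists_pos_exp_sub_one_mul_le {n : ℝ} : ∃ s : ℝ, 0 < s ∧
    4 * (Real.exp (2 * (n * s)) - 1) * n ≤ 1 := by
  have hcont : Continuous fun s : ℝ => 4 * (Real.exp (2 * (n * s)) - 1) * n := by fun_prop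
  have h0 : (fun s : ℝ => 4 * (Real.exp (2 * (n * s)) - 1) * n) 0 < 1 := by simp
  have h : ∀ᶠ s in nhdsWithin (0 : ℝ) (Set.Ioi 0), 4 * (Real.exp (2 * (n * s)) - 1) * n < 1 :=
    nhdsWithin_le_nhds (hcont.continuousAt.eventually_lt_const h0)
  obtain ⟨s, hs, hs0⟩ := (h.and self_mem_nhdsWithin).exists
  exact ⟨s, hs0, hs.le⟩

lemma exists_pos_abs_log_sub_le {z s : ℝ} (hz : 0 < z) (hs : 0 < s) :
    ∃ ε : ℝ, 0 < ε ∧ ∀ y, |y - z| ≤ ε → |Real.log y - Real.log z| ≤ s := by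
  obtain ⟨ε, hε, h⟩ := Metric.continuousAt_iff.1 (Real.continuousAt_log hz.ne') s hs
  refine ⟨ε / 2, by positivity, fun y hy => ?_⟩
  have := h (x := y) (by rw [Real.dist_eq]; linarith)
  rw [Real.dist_eq] at this
  exact this.le

/-- stability of strong mixing under inhomogeneous activity
perturbations. If the lattice gas potential `U = (z, U_{>1})` satisfies SM(ℓ0,b,B),
then there are `ε > 0`, a multiple `ℓ0'` of `ℓ0` and constants `b', B' > 0` such that
for every family of activities `z̲ = (z_x)` with `|z_x − z| ≤ ε` for all `x`, the
lattice gas potential with inhomogeneous activity `(z̲, U_{>1})` satisfies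
SM(ℓ0',b',B'). -/
theorem stmt13 {d : ℕ} (hd : 0 < d) (G : LatticeGas d)
    (ℓ0 : ℕ) (hℓ0 : 0 < ℓ0) (b B : ℝ) (hb : 0 < b) (hB : 0 < B)
    (hSM : SM (gasPotH G) ℓ0 b B) :
    ∃ ε : ℝ, 0 < ε ∧ ∃ ℓ0' : ℕ, 0 < ℓ0' ∧ ℓ0 ∣ ℓ0' ∧
      ∃ b' B' : ℝ, 0 < b' ∧ 0 < B' ∧
        ∀ zf : ZLat d → ℝ, (∀ x, 0 ≤ zf x) → (∀ x, |zf x - G.z| ≤ ε) →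
          SM (gasPot G zf) ℓ0' b' B' := by
  obtain ⟨K, hK0, hK⟩ := G.exists_bound
  set D : ℝ := B * Real.exp (2 * (2 ^ ((2 * G.r + 1) ^ d) * (2 * K))) *
    ((2 * G.r + 1 : ℕ) : ℝ) ^ d with hD
  have hD0 : 0 ≤ D := by positivity
  obtain ⟨k, L, hL, hk, hkL⟩ := exists_block_size d G.r hb
    (by positivity : 0 ≤ 2 * D * (ℓ0 : ℝ) ^ d)
  set nV : ℝ := (L : ℝ) ^ d * (ℓ0 : ℝ) ^ d with hnV
  obtain ⟨s, hs0, hs⟩ := exists_pos_exp_sub_one_mul_le (n := nV)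
  obtain ⟨ε, hε, hlog⟩ := exists_pos_abs_log_sub_le G.zpos hs0
  set M : ℝ := 4 * ((2 * (k + G.r) + 1 : ℕ) : ℝ) ^ d +
    (4 * (Real.exp (2 * (nV * s)) - 1) + 2 * (D * Real.exp (-b * k))) * nV with hM
  have hML : M * (((L + 2 * G.r : ℕ) : ℝ) ^ d - (L : ℝ) ^ d) ≤ (L : ℝ) ^ d / 2 := by
    refine le_trans (mul_le_mul_of_nonneg_right ?_ (sub_nonneg.2 ?_)) hkL
    · rw [hM, add_mul]
      rw [hnV] at hs ⊢
      linarith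
    · exact pow_le_pow_left₀ (Nat.cast_nonneg _) (Nat.cast_le.2 (Nat.le_add_right _ _)) d
  set δ : ℝ := Real.log 2 / (ℓ0 * L + G.r + 1) with hδ
  have hlog2 : 0 < Real.log 2 := Real.log_pos (by norm_num)
  have hδ0 : 0 < δ := by positivity
  have hδ2 : Real.exp (δ * (ℓ0 * L + G.r)) ≤ 2 := by
    rw [← Real.exp_log (by norm_num : (0 : ℝ) < 2)]
    refine Real.exp_le_exp.2 ?_
    rw [hδ, div_mul_eq_mul_div, div_le_iff₀ (by positivity)]
    exact mul_le_mul_of_nonneg_left (by linarith) hlog2.le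
  refine ⟨ε, hε, ℓ0, hℓ0, dvd_rfl, δ, 16 * ((2 * (ℓ0 * L) + 1 : ℕ) : ℝ) ^ d, hδ0,
    by positivity, fun zf _ hzf I f g Sf Sg hf hg hSf hSg _ τ => ?_⟩
  have hz : ∀ x, |Real.log (zf x) - Real.log G.z| ≤ s := fun x => hlog _ (hzf x)
  rcases le_total Sg.card Sf.card with h | h
  · rw [min_eq_right (Nat.cast_le.2 h)]
    exact hSM.abs_cov_perturbed_le hℓ0 hb hB hK hk hL hM hML hδ0 hδ2 hz I hf hg hSf τ
  · rw [min_eq_left (Nat.cast_le.2 h), fDist_comm Sf Sg]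
    have := hSM.abs_cov_perturbed_le hℓ0 hb hB hK hk hL hM hML hδ0 hδ2 hz I hg hf hSg τ
    rw [mul_right_comm _ (supNorm f), mul_comm (gibbsExp _ _ τ f)]
    simpa only [mul_comm (f _)] using this

end

end Paper
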